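/- arXiv:math/9811035 — 2 statements merged into one kernel-verified Lean document; each statement's English description precedes it below -/
import Mathlib

section
/- Let J1 and J2 be reduced Albert algebras over a field F of characteristic not 2 or 3. Then B(J1,F×F) and B(J2,F×F) are similar (i.e. there is a similarity between their associated triple systems) if and only if J1 and J2 are isotopic Jordan algebras. -/
set_option synthInstance.maxHeartbeats 1000000
set_option maxHeartbeats 1000000

noncomputable section

open scoped TensorProduct

universe u v

structure OctonionAlgebra (F : Type u) [Field F] : Type (max u (v + 1)) where
  C : Type v
  [ringC : NonAssocRing C]
  [modC : Module F C]
  [sccC : SMulCommClass F C C]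
  [istC : IsScalarTower F C C]
  n : QuadraticForm F C
  finrank_eq : Module.finrank F C = 8
  nondeg : ∀ x : C, (∀ y : C, QuadraticMap.polar (⇑n) x y = 0) → x = 0
  n_one : n 1 = 1
  n_mul : ∀ x y : C, n (x * y) = n x * n y

attribute [instance] OctonionAlgebra.ringC OctonionAlgebra.modC OctonionAlgebra.sccC
  OctonionAlgebra.istC

namespace OctonionAlgebra

variable {F : Type u} [Field F] (O : OctonionAlgebra.{u, v} F)

/-- Conjugation `x̄ := n(x,1)•1 - x` (bundled as a linear map; `polarBilin n x 1 = n(x,1)`). -/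
def conj : O.C →ₗ[F] O.C :=
  (LinearMap.toSpanSingleton F O.C (1 : O.C)).comp ((QuadraticMap.polarBilin O.n).flip 1)
    - LinearMap.id

lemma conj_apply (x : O.C) :
    O.conj x = QuadraticMap.polar (⇑O.n) x 1 • (1 : O.C) - x := rfl

/-- A split octonion algebra: the norm form is isotropic. -/
def IsSplit : Prop := ∃ x : O.C, x ≠ 0 ∧ O.n x = 0

end OctonionAlgebra

/-- A reduced Albert algebra `H₃(C,γ)`. -/
structure ReducedAlbert (F : Type u) [Field F] : Type (max u (v + 1)) where
  O : OctonionAlgebra.{u, v} F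
  γ : Fin 3 → Fˣ

namespace ReducedAlbert

variable {F : Type u} [Field F] (A : ReducedAlbert.{u, v} F)

/-- The ambient space of 3×3 matrices over the octonion algebra. -/
abbrev M : Type v := Matrix (Fin 3) (Fin 3) A.O.C

/-- The 27-dimensional space `H₃(C,γ)` of `γ`-hermitian matrices:
`x = γ⁻¹ ⬝ (x̄)ᵀ ⬝ γ`, i.e. entrywise `x i j = γᵢ⁻¹ γⱼ • conj (x j i)`. -/
def J : Submodule F A.M where
  carrier := {x | ∀ i j, x i j = ((A.γ i : F)⁻¹ * (A.γ j : F)) • A.O.conj (x j i)}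
  add_mem' := by
    intro a b ha hb i j
    show a i j + b i j = ((A.γ i : F)⁻¹ * (A.γ j : F)) • A.O.conj (a j i + b j i)
    rw [map_add, smul_add, ← ha i j, ← hb i j]
  zero_mem' := by
    intro i j
    show (0 : A.O.C) = ((A.γ i : F)⁻¹ * (A.γ j : F)) • A.O.conj (0 : A.O.C)
    rw [map_zero, smul_zero]
  smul_mem' := by
    intro c a ha i j
    show c • a i j = ((A.γ i : F)⁻¹ * (A.γ j : F)) • A.O.conj (c • a j i)
    rw [map_smul, smul_comm, ← ha i j]

/-- The Jordan product `x·y := (xy + yx)/2`. -/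
def jmul (x y : A.M) : A.M := (2 : F)⁻¹ • (x * y + y * x)

/-- The trace `T(x)`: the sum of the diagonal entries, which for hermitian matrices are
scalars `ε•1`; the scalar `ε` is recovered as `n(ε•1, 1)/2`. -/
def trace (x : A.M) : F := (2 : F)⁻¹ * ∑ i, QuadraticMap.polar (⇑A.O.n) (x i i) 1

/-- The trace bilinear form `T(x,y) := T(x·y)`. -/
def tb (x y : A.M) : F := A.trace (A.jmul x y)

/-- The adjoint `x ^ # = x·x − T(x)·x + ½(T(x)² − T(x,x))·1`, the unique quadratic map such
that `T(x^#, y)` is the coefficient of `s` in `N(x + s y)`. -/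
def sharp (x : A.M) : A.M :=
  A.jmul x x - A.trace x • x + ((2 : F)⁻¹ * (A.trace x ^ 2 - A.tb x x)) • (1 : A.M)

/-- The Freudenthal cross product `x × y := (x+y)^# − x^# − y^#`. -/
def cross (x y : A.M) : A.M := A.sharp (x + y) - A.sharp x - A.sharp y

/-- The cubic norm `N`, defined pointwise on `J` by
`N(x)·1 = x·(x·x) − T(x)·(x·x) + ½(T(x)² − T(x,x))·x`; the scalar is recovered by
applying the trace (which takes value `3` on `1`). -/
def norm (x : A.M) : F :=
  (3 : F)⁻¹ * A.trace (A.jmul x (A.jmul x x) - A.trace x • A.jmul x x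
    + ((2 : F)⁻¹ * (A.trace x ^ 2 - A.tb x x)) • x)

/-- The operator `⟨x,y⟩(j) := ½ (y × (x × j) − T(j,y)·x − ⅓·T(x,y)·j)`. -/
def brok (x y j : A.M) : A.M :=
  (2 : F)⁻¹ • (A.cross y (A.cross x j) - A.tb j y • x - ((3 : F)⁻¹ * A.tb x y) • j)

/-- `A` is the split Albert algebra `H₃(Cᵈ, 1)`. -/
def IsSplitAlbert : Prop := A.O.IsSplit ∧ ∀ i, A.γ i = 1

/-- A point of `H₃(C,γ)` with coordinates `(ε₀,ε₁,ε₂; a,b,c)`. -/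
def elt (ε : Fin 3 → F) (a b c : A.O.C) : A.M :=
  Matrix.of
    ![![ε 0 • (1 : A.O.C), c, ((A.γ 0 : F)⁻¹ * (A.γ 2 : F)) • A.O.conj b],
      ![((A.γ 1 : F)⁻¹ * (A.γ 0 : F)) • A.O.conj c, ε 1 • (1 : A.O.C), a],
      ![b, ((A.γ 2 : F)⁻¹ * (A.γ 1 : F)) • A.O.conj a, ε 2 • (1 : A.O.C)]]

/-! ### The Brown algebra `B(J, F×F, ζ)` -/

/-- Ambient space of the Brown algebra `B(J, F×F, ζ)`: elements `(α, j; j', β)`. -/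
abbrev Bam : Type (max u v) := F × A.M × A.M × F

/-- The underlying 56-dimensional space of `B(J, F×F, ζ)`: both middle components lie in `J`. -/
def Bsub : Submodule F A.Bam where
  carrier := {p | p.2.1 ∈ A.J ∧ p.2.2.1 ∈ A.J}
  add_mem' := fun ha hb => ⟨A.J.add_mem ha.1 hb.1, A.J.add_mem ha.2 hb.2⟩
  zero_mem' := ⟨A.J.zero_mem, A.J.zero_mem⟩
  smul_mem' := fun c _ h => ⟨A.J.smul_mem c h.1, A.J.smul_mem c h.2⟩

/-- The product of `B(J, F×F, ζ)`. -/
def bmul (ζ : F) (x y : A.Bam) : A.Bam :=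
  (x.1 * y.1 + ζ * A.tb x.2.1 y.2.2.1,
   x.1 • y.2.1 + y.2.2.2 • x.2.1 + ζ • A.cross x.2.2.1 y.2.2.1,
   y.1 • x.2.2.1 + x.2.2.2 • y.2.2.1 + A.cross x.2.1 y.2.1,
   x.2.2.2 * y.2.2.2 + ζ * A.tb y.2.1 x.2.2.1)

/-- The involution `(α,j;j',β)‾ = (β,j;j',α)` of `B(J, F×F, ζ)`. -/
def binv (x : A.Bam) : A.Bam := (x.2.2.2, x.2.1, x.2.2.1, x.1)

/-- The skew-symmetric element `s₀ = (1,0;0,−1)`. -/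
def s0 : A.Bam := (1, 0, 0, -1)

/-- The triple product `{x,y,z} := (x·ȳ)·z + (z·ȳ)·x − (z·x̄)·y` in `B(J, F×F, ζ)`. -/
def brace (ζ : F) (x y z : A.Bam) : A.Bam :=
  A.bmul ζ (A.bmul ζ x (A.binv y)) z + A.bmul ζ (A.bmul ζ z (A.binv y)) x
    - A.bmul ζ (A.bmul ζ z (A.binv x)) y

/-- The bilinear form of the triple system associated to `B(J, F×F, ζ)` and a skew element
`s`: `b(x,y)` is the unique scalar with `b(x,y)•1 = (x·ȳ − y·x̄)·s`; since the unit of the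
algebra is `(1,0;0,1)`, it is the first component of the right-hand side. -/
def bformS (ζ : F) (s x y : A.Bam) : F :=
  (A.bmul ζ (A.bmul ζ x (A.binv y) - A.bmul ζ y (A.binv x)) s).1

/-- The trilinear product of the triple system associated to `B(J, F×F, ζ)` and `s`:
`t(y,z,w) := 2{y, s·z, w} − b(z,w)·y − b(z,y)·w − b(y,w)·z`. -/
def tformS (ζ : F) (s y z w : A.Bam) : A.Bam :=
  (2 : F) • A.brace ζ y (A.bmul ζ s z) w - A.bformS ζ s z w • y - A.bformS ζ s z y • w
    - A.bformS ζ s y w • z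

/-- The bilinear form of the triple system associated to `B(J, F×F, ζ)` and `s₀`. -/
def bform (ζ : F) (x y : A.Bam) : F := A.bformS ζ A.s0 x y

/-- The trilinear product of the triple system associated to `B(J, F×F, ζ)` and `s₀`. -/
def tform (ζ : F) (y z w : A.Bam) : A.Bam := A.tformS ζ A.s0 y z w

/-- `e` is a singular element of `B(J, F×F, ζ)`: `e ≠ 0` and `U_e(B) ⊆ F·e`
where `U_e(x) := {e,x,e}`. -/
def IsSingular (ζ : F) (e : A.Bam) : Prop :=
  e ≠ 0 ∧ ∀ x ∈ A.Bsub, ∃ c : F, A.brace ζ e x e = c • e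

/-- `I` is an inner ideal of `B(J, F×F, ζ)`: a subspace of `B` with `U_e(B) ⊆ I`
for all `e ∈ I`. -/
def IsInnerIdeal (ζ : F) (I : Submodule F A.Bam) : Prop :=
  I ≤ A.Bsub ∧ ∀ e ∈ I, ∀ x ∈ A.Bsub, A.brace ζ e x e ∈ I

end ReducedAlbert

universe w

/-- A nondegenerate cubic norm structure in characteristic not `2` or `3`, presented by its trace
bilinear form, its Freudenthal cross product and its base point. -/
structure CubicNormStructure (F : Type u) (V : Type v) [Field F] [AddCommGroup V] [Module F V] where
  T : V →ₗ[F] V →ₗ[F] F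
  X : V →ₗ[F] V →ₗ[F] V
  one : V
  two_ne : (2 : F) ≠ 0
  three_ne : (3 : F) ≠ 0
  T_comm : ∀ x y, T x y = T y x
  X_comm : ∀ x y, X x y = X y x
  T_X : ∀ x y z, T (X x y) z = T x (X y z)
  T_nondeg : ∀ x, (∀ y, T x y = 0) → x = 0
  X_one : ∀ x, X one x = T one x • one - x
  T_one_one : T one one = 3
  adjoint : ∀ x, (3 : F) • X (X x x) (X x x) = (4 * T (X x x) x) • x

namespace CubicNormStructure

variable {F : Type u} {V : Type v} [Field F] [AddCommGroup V] [Module F V]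
  (S : CubicNormStructure F V)

/-- The adjoint `x ↦ x^#`. -/
def sharp (x : V) : V := (2 : F)⁻¹ • S.X x x

/-- The cubic norm. -/
def norm (x : V) : F := (3 : F)⁻¹ * S.T (S.sharp x) x

lemma ext_T {x y : V} (h : ∀ z, S.T x z = S.T y z) : x = y :=
  sub_eq_zero.mp <| S.T_nondeg _ fun z => by simp [h z]

lemma T_X_comm (x y z : V) : S.T (S.X x y) z = S.T (S.X x z) y := by
  rw [S.X_comm x y, S.T_X, S.T_comm]

lemma T_X_rotate (x y z : V) : S.T (S.X x y) z = S.T (S.X y z) x := by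
  rw [S.T_X, S.T_comm]

lemma X_self (x : V) : S.X x x = (2 : F) • S.sharp x := by
  simp [sharp, smul_smul, S.two_ne]

lemma T_sharp_self (x : V) : S.T (S.sharp x) x = 3 * S.norm x := by
  have := S.three_ne
  simp only [norm]; field_simp

lemma sharp_add (x y : V) : S.sharp (x + y) = S.sharp x + S.X x y + S.sharp y := by
  have := S.two_ne
  simp only [sharp, map_add, LinearMap.add_apply, S.X_comm y x]
  match_scalars <;> (field_simp; try ring)

lemma sharp_smul (c : F) (x : V) : S.sharp (c • x) = c ^ 2 • S.sharp x := by
  simp only [sharp, map_smul, LinearMap.smul_apply]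
  module

lemma sharp_neg (x : V) : S.sharp (-x) = S.sharp x := by
  simp [sharp]

lemma norm_smul (c : F) (x : V) : S.norm (c • x) = c ^ 3 * S.norm x := by
  simp only [norm, sharp_smul, map_smul, LinearMap.smul_apply, smul_eq_mul]
  ring

lemma norm_neg (x : V) : S.norm (-x) = -S.norm x := by
  simp [norm, sharp_neg]

lemma T_X_left_self (x y : V) : S.T (S.X x y) x = 2 * S.T (S.sharp x) y := by
  rw [T_X_comm, X_self]; simp

lemma T_X_right_self (x y : V) : S.T (S.X x y) y = 2 * S.T (S.sharp y) x := by
  rw [S.X_comm, T_X_left_self]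

lemma norm_add (x y : V) :
    S.norm (x + y) = S.norm x + S.T (S.sharp x) y + S.T (S.sharp y) x + S.norm y := by
  have := S.three_ne
  simp only [norm, sharp_add, map_add, LinearMap.add_apply, T_X_left_self, T_X_right_self]
  field_simp; ring

lemma sharp_sharp (x : V) : S.sharp (S.sharp x) = S.norm x • x := by
  have h2 := S.two_ne
  have h3 := S.three_ne
  have h := congrArg (((2 : F)⁻¹ ^ 3 * 3⁻¹) • ·) (S.adjoint x)
  simp only [sharp, norm, map_smul, LinearMap.smul_apply, smul_eq_mul, smul_smul] at h ⊢
  convert h using 2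
  · field_simp
  · field_simp
    ring

lemma sharp_sharp_polar (x y : V) :
    S.X (S.sharp x) (S.X x y) = S.norm x • y + S.T (S.sharp x) y • x ∧
    S.X (S.sharp x) (S.sharp y) + S.sharp (S.X x y)
      = S.T (S.sharp x) y • y + S.T (S.sharp y) x • x := by
  have h2 := S.two_ne
  have h3 := S.three_ne
  have key (s : F) :
      s • (S.X (S.sharp x) (S.X x y) - S.norm x • y - S.T (S.sharp x) y • x)
      + s ^ 2 • (S.X (S.sharp x) (S.sharp y) + S.sharp (S.X x y)
        - S.T (S.sharp x) y • y - S.T (S.sharp y) x • x)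
      + s ^ 3 • (S.X (S.sharp y) (S.X x y) - S.norm y • x - S.T (S.sharp y) x • y) = 0 := by
    have h := S.sharp_sharp (x + s • y)
    have hx := S.sharp_sharp x
    have hy := S.sharp_sharp y
    simp only [sharp_add, norm_add, sharp_smul, norm_smul, map_add, map_smul, LinearMap.add_apply,
      LinearMap.smul_apply, hx, hy, S.X_comm (S.X x y), smul_eq_mul] at h
    linear_combination (norm := module) h
  have h1 := key 1
  have hm := key (-1)
  have hd := key 2
  generalize hp : S.X (S.sharp x) (S.X x y) - S.norm x • y - S.T (S.sharp x) y • x = p at *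
  generalize hq : S.X (S.sharp x) (S.sharp y) + S.sharp (S.X x y)
    - S.T (S.sharp x) y • y - S.T (S.sharp y) x • x = q at *
  have hq0 : q = 0 := by
    refine (smul_eq_zero_iff_right h2).mp ?_
    linear_combination (norm := module) h1 + hm
  have hp0 : p = 0 := by
    refine (smul_eq_zero_iff_right (mul_ne_zero h2 h3)).mp ?_
    linear_combination (norm := module) (8 : F) • h1 - hd - (4 : F) • hq0
  constructor
  · linear_combination (norm := module) hp + hp0
  · linear_combination (norm := module) hq + hq0

lemma X_sharp_X (x y : V) :
    S.X (S.sharp x) (S.X x y) = S.norm x • y + S.T (S.sharp x) y • x :=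
  (S.sharp_sharp_polar x y).1

lemma sharp_X (x y : V) :
    S.sharp (S.X x y)
      = S.T (S.sharp x) y • y + S.T (S.sharp y) x • x - S.X (S.sharp x) (S.sharp y) := by
  linear_combination (norm := module) (S.sharp_sharp_polar x y).2

lemma X_X_X_X (x y z : V) :
    S.X (S.X x y) (S.X x z) = S.T (S.sharp x) y • z + S.T (S.sharp x) z • y
      + S.T (S.X y z) x • x - S.X (S.sharp x) (S.X y z) := by
  have hy := S.sharp_X x y
  have hz := S.sharp_X x z
  have h := S.sharp_X x (y + z)
  simp only [map_add, sharp_add, LinearMap.add_apply] at h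
  linear_combination (norm := module) h - hy - hz

lemma X_X_sharp (x y : V) :
    S.X x (S.X (S.sharp x) y) = S.norm x • y + S.T x y • S.sharp x := by
  refine S.ext_T fun z => ?_
  rw [S.T_X_comm x, S.T_comm, S.T_X_comm, S.X_sharp_X]
  simp [S.T_comm z y]
  ring

lemma X_X_sharp_polar (x y z : V) :
    S.X z (S.X (S.sharp x) y) + S.X x (S.X (S.X x z) y)
      = S.T (S.sharp x) z • y + S.T z y • S.sharp x + S.T x y • S.X x z := by
  refine (smul_right_injective V S.two_ne) ?_
  have hp := S.X_X_sharp (x + z) y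
  have hm := S.X_X_sharp (x + -z) y
  have hz := S.X_X_sharp z y
  simp only [sharp_add, norm_add, sharp_neg, norm_neg, map_add, LinearMap.add_apply, map_neg,
    LinearMap.neg_apply] at hp hm
  linear_combination (norm := module) hp - hm - (2 : F) • hz

lemma norm_sharp (x : V) : S.norm (S.sharp x) = S.norm x ^ 2 := by
  have := S.three_ne
  have h := S.T_sharp_self (S.sharp x)
  simp only [sharp_sharp, map_smul, LinearMap.smul_apply, smul_eq_mul, S.T_comm x,
    T_sharp_self] at h
  refine mul_left_cancel₀ this ?_
  linear_combination -h

lemma norm_X (x y : V) :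
    S.norm (S.X x y) = S.T (S.sharp x) y * S.T (S.sharp y) x - S.norm x * S.norm y := by
  have h3 := S.three_ne
  have h : S.T (S.X (S.sharp x) (S.sharp y)) (S.X x y)
      = 3 * S.norm x * S.norm y + S.T (S.sharp x) y * S.T (S.sharp y) x := by
    rw [S.X_comm, T_X, X_sharp_X]
    simp [T_sharp_self]
    ring
  have h' := S.T_sharp_self (S.X x y)
  simp only [sharp_X, map_sub, map_add, map_smul, LinearMap.sub_apply, LinearMap.add_apply,
    LinearMap.smul_apply, h, smul_eq_mul, S.T_comm y (S.X x y), S.T_comm x (S.X x y),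
    T_X_left_self, T_X_right_self] at h'
  refine mul_left_cancel₀ h3 ?_
  linear_combination -h'

lemma sharp_one : S.sharp S.one = S.one := by
  have h2 := S.two_ne
  rw [sharp, X_one, T_one_one]
  match_scalars
  field_simp; norm_num

lemma norm_one : S.norm S.one = 1 := by
  have h3 := S.three_ne
  simp [norm, sharp_one, T_one_one, h3]

lemma one_ne_zero : S.one ≠ 0 := by
  intro h
  have := S.norm_one
  simp [h, norm] at this

lemma X_polar (x y z w : V) :
    S.X (S.X x y) (S.X z w) + S.X (S.X x z) (S.X y w) + S.X (S.X x w) (S.X y z)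
      = S.T (S.X x y) z • w + S.T (S.X x y) w • z + S.T (S.X x z) w • y
        + S.T (S.X y z) w • x := by
  have hx := S.X_X_X_X x y z
  have hw := S.X_X_X_X w y z
  have h := S.X_X_X_X (x + w) y z
  simp only [map_add, sharp_add, LinearMap.add_apply] at h
  rw [S.X_comm w y, S.X_comm w z, S.X_comm (S.X y w), S.T_X_comm x w y,
    S.T_X_comm x w z] at h
  rw [S.X_comm w y, S.X_comm w z] at hw
  rw [← S.T_X_rotate x y z] at h hx
  linear_combination (norm := module) h - hx - hw

/-- The Jordan product. -/
def jmul (x y : V) : V :=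
  (2 : F)⁻¹ • (S.X x y + S.T x S.one • y + S.T y S.one • x
    - (S.T x S.one * S.T y S.one - S.T x y) • S.one)

/-- The Jordan product of the `u`-isotope. -/
def isoMul (u x y : V) : V :=
  (2 : F)⁻¹ • (S.T x u • y + S.T y u • x - S.X (S.X x y) u)

lemma X_one' (x : V) : S.X x S.one = S.T x S.one • S.one - x := by
  rw [S.X_comm, X_one, S.T_comm]

lemma T_X_one (x y : V) : S.T (S.X x y) S.one = S.T x S.one * S.T y S.one - S.T x y := by
  rw [T_X, X_one']
  simp
  ring

lemma isoMul_one (x y : V) : S.isoMul S.one x y = S.jmul x y := by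
  rw [isoMul, jmul, X_one', T_X_one]
  module

lemma jmul_isotope (u x y : V) :
    S.jmul (S.jmul x u) y + S.jmul (S.jmul y u) x - S.jmul (S.jmul x y) u = S.isoMul u x y := by
  have h2 := S.two_ne
  have h := S.X_polar x y u S.one
  rw [S.X_comm (S.X x S.one)] at h
  simp only [X_one', map_sub, map_smul, T_X_one] at h
  simp only [jmul, isoMul, map_add, map_sub, map_smul, LinearMap.add_apply, LinearMap.smul_apply,
    LinearMap.sub_apply, S.X_one, S.T_one_one, smul_eq_mul, T_X_one]
  simp only [S.T_comm S.one u, S.T_comm S.one x, S.T_comm S.one y, ← S.T_X_rotate x y u,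
    S.T_X_comm x u y, S.T_comm u x, S.T_comm u y, S.T_comm y x, S.X_comm u x, S.X_comm u y,
    S.X_comm y x]
  linear_combination (norm := skip) (-(2 : F)⁻¹ ^ 2) • h
  match_scalars <;> (field_simp; try ring)

lemma isoMul_comm (u x y : V) : S.isoMul u x y = S.isoMul u y x := by
  rw [isoMul, isoMul, S.X_comm x y]
  module

lemma isoMul_self (u x : V) : S.isoMul u x x = S.T x u • x - S.X (S.sharp x) u := by
  have h2 := S.two_ne
  rw [isoMul, X_self]
  simp
  match_scalars <;> (field_simp; try ring)

lemma T_isoMul (u x y : V) :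
    S.T (S.isoMul u x y) u = S.T x u * S.T y u - S.T (S.X x y) (S.sharp u) := by
  have h2 := S.two_ne
  simp only [isoMul, map_smul, map_add, map_sub, LinearMap.smul_apply, LinearMap.add_apply,
    LinearMap.sub_apply, smul_eq_mul, T_X_right_self, S.T_comm (S.sharp u)]
  field_simp
  ring

lemma isoMul_cube (u x : V) :
    S.isoMul u x (S.isoMul u x x)
      = S.T x u • S.isoMul u x x - S.T (S.sharp x) (S.sharp u) • x + S.norm x • S.sharp u := by
  have h2 := S.two_ne
  have h := S.X_X_sharp x u
  rw [isoMul, T_isoMul, isoMul_self]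
  simp only [map_sub, map_smul, h, LinearMap.sub_apply, LinearMap.smul_apply,
    LinearMap.add_apply, map_add, S.X_self, smul_eq_mul]
  match_scalars <;> (field_simp; try ring)

lemma isoMul_sharp (u y : V) : S.isoMul u (S.sharp u) y = S.norm u • y := by
  have h2 := S.two_ne
  have h := S.X_X_sharp u y
  rw [isoMul, S.X_comm _ u, h, T_sharp_self, S.T_comm y]
  match_scalars <;> (field_simp; try ring)

lemma jmul_one (x : V) : S.jmul S.one x = x := by
  rw [← isoMul_one]
  nth_rewrite 2 [← S.sharp_one]
  rw [isoMul_sharp, norm_one, one_smul]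

/-! ### Norm similarities and isotopies -/

section Maps

variable {V' : Type w} [AddCommGroup V'] [Module F V'] {S} {S' : CubicNormStructure F V'}
  {g : V ≃ₗ[F] V'} {μ : F}

lemma T_sharp_map (hN : ∀ x, S'.norm (g x) = μ * S.norm x) (x y : V) :
    S'.T (S'.sharp (g x)) (g y) = μ * S.T (S.sharp x) y := by
  have hp := hN (x + y)
  have hm := hN (x + -y)
  have hy := hN y
  simp only [map_add, map_neg, norm_add, norm_neg, sharp_neg] at hp hm
  refine mul_left_cancel₀ S.two_ne ?_
  linear_combination hp - hm - 2 * hy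

variable {g' : V →ₗ[F] V'}

lemma sharp_map (hN : ∀ x, S'.norm (g x) = μ * S.norm x) (hT : ∀ x y, S'.T (g x) (g' y) = S.T x y)
    (x : V) : S'.sharp (g x) = μ • g' (S.sharp x) := by
  refine S'.ext_T fun z => ?_
  obtain ⟨y, rfl⟩ := g.surjective z
  rw [T_sharp_map hN, map_smul, LinearMap.smul_apply, S'.T_comm, hT, S.T_comm, smul_eq_mul]

lemma X_map_of_sharp_map {V V' : Type*} [AddCommGroup V] [Module F V] [AddCommGroup V']
    [Module F V'] {S : CubicNormStructure F V} {S' : CubicNormStructure F V'}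
    {g g' : V →ₗ[F] V'} {μ : F} (h : ∀ x, S'.sharp (g x) = μ • g' (S.sharp x)) (x y : V) :
    S'.X (g x) (g y) = μ • g' (S.X x y) := by
  have hs := h (x + y)
  simp only [map_add, sharp_add] at hs
  linear_combination (norm := module) hs - h x - h y

lemma sharp_map_dual (hN : ∀ x, S'.norm (g x) = μ * S.norm x)
    (hT : ∀ x y, S'.T (g x) (g' y) = S.T x y) (hμ : μ ≠ 0) (y : V) :
    S'.sharp (g' y) = μ⁻¹ • g (S.sharp y) := by
  have hs := sharp_map hN hT
  have hX := X_map_of_sharp_map (g := g.toLinearMap) hs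
  obtain ⟨w, hw⟩ := g.surjective S'.one
  have hNw : S.norm w ≠ 0 := by
    intro h
    have := hN w
    rw [hw, norm_one, h] at this
    simp at this
  have surj (y : V) : ∃ z, S.X w z = y := by
    refine ⟨(S.norm w)⁻¹ • (S.X (S.sharp w) y - ((2 : F)⁻¹ * S.T w y) • w), ?_⟩
    have h2 := S.two_ne
    simp only [map_smul, map_sub, X_X_sharp, X_self]
    match_scalars <;> field_simp
    ring
  have key (y : V) : μ • S'.X (g' (S.sharp w)) (g' y) = g (S.X (S.sharp w) y) := by
    obtain ⟨z, rfl⟩ := surj y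
    have h := S'.X_sharp_X (g w) (g z)
    have hX' := hX w z
    simp only [LinearEquiv.coe_coe] at hX'
    rw [hX', T_sharp_map hN, hN, hs] at h
    simp only [map_smul, LinearMap.smul_apply] at h
    rw [X_sharp_X]
    refine smul_right_injective _ hμ ?_
    simp only [map_add, map_smul]
    linear_combination (norm := module) h
  obtain ⟨z, rfl⟩ := surj y
  have h := S'.sharp_X (g w) (g z)
  have hX' := hX w z
  simp only [LinearEquiv.coe_coe] at hX'
  have hk := key (S.sharp z)
  rw [hX', sharp_smul, T_sharp_map hN, T_sharp_map hN, hs, hs] at h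
  simp only [map_smul, LinearMap.smul_apply] at h
  rw [sharp_X]
  refine smul_right_injective _ (pow_ne_zero 2 hμ) ?_
  simp only [map_sub, map_add, map_smul, smul_smul]
  have hμ' : μ ^ 2 * μ⁻¹ = μ := by field_simp
  rw [hμ']
  linear_combination (norm := module) h - μ • hk

/-- A norm similarity is an isotopy. -/
theorem exists_isotope_of_norm_similarity (hN : ∀ x, S'.norm (g x) = μ * S.norm x)
    (hT : ∀ x y, S'.T (g x) (g' y) = S.T x y) (hμ : μ ≠ 0) :
    ∃ u, S.norm u ≠ 0 ∧ ∀ x y, g (S.isoMul u x y) = S'.jmul (g x) (g y) := by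
  obtain ⟨w, hw⟩ := g.surjective S'.one
  have hs := sharp_map hN hT
  have hX := X_map_of_sharp_map (g := g.toLinearMap) hs
  have hX' := X_map_of_sharp_map (g' := g.toLinearMap) (sharp_map_dual hN hT hμ)
  simp only [LinearEquiv.coe_coe] at hX hX'
  have hNw : S.norm w ≠ 0 := by
    intro h
    have := hN w
    rw [hw, norm_one, h] at this
    simp at this
  have hsw := hs w
  rw [hw, sharp_one] at hsw
  refine ⟨μ • S.sharp w, ?_, fun x y => ?_⟩
  · rw [norm_smul, norm_sharp]
    positivity
  have ht (x : V) : μ * S.T x (S.sharp w) = S'.T (g x) S'.one := by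
    rw [S.T_comm, ← T_sharp_map hN, hw, sharp_one, S'.T_comm]
  have hXX : S'.X (S'.X (g x) (g y)) S'.one = μ • g (S.X (S.X x y) (S.sharp w)) := by
    rw [hX]
    nth_rewrite 1 [hsw]
    simp only [map_smul, LinearMap.smul_apply, hX', smul_smul]
    congr 1
    field_simp
  rw [← isoMul_one, isoMul, isoMul, hXX]
  simp only [map_smul, map_sub, map_add, smul_eq_mul, ht]

/-- An isotopy onto a cubic norm structure whose trace is determined by the degree `3` relation
is a norm similarity. -/
theorem norm_map_of_isotope {u : V}
    (hcub : ∀ f : V' →ₗ[F] F, (∀ y, ∃ a b : F, f y • S'.jmul y y = a • y + b • S'.one) → f = 0)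
    (hg : ∀ x y, g (S.isoMul u x y) = S'.jmul (g x) (g y)) (x : V) :
    S'.norm (g x) = S.norm u * S.norm x := by
  have hone : g (S.sharp u) = S.norm u • S'.one := by
    obtain ⟨w, hw⟩ := g.surjective S'.one
    have h := hg (S.sharp u) w
    rw [isoMul_sharp, map_smul, hw, ← isoMul_one, isoMul_comm, isoMul_one, jmul_one] at h
    exact h.symm
  have h₁ (x : V) := congrArg g (S.isoMul_cube u x)
  have h₂ (x : V) := S'.isoMul_cube S'.one (g x)
  simp only [map_add, map_sub, map_smul, hg, hone] at h₁
  simp only [isoMul_one, sharp_one] at h₂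
  have hf : S'.T.flip S'.one - (S.T.flip u).comp g.symm.toLinearMap = 0 := by
    refine hcub _ fun y => ?_
    obtain ⟨x, rfl⟩ := g.surjective y
    refine ⟨S'.T (S'.sharp (g x)) S'.one - S.T (S.sharp x) (S.sharp u),
      S.norm x * S.norm u - S'.norm (g x), ?_⟩
    simp only [LinearMap.sub_apply, LinearMap.flip_apply, LinearMap.comp_apply,
      LinearEquiv.coe_coe, LinearEquiv.symm_apply_apply]
    linear_combination (norm := module) h₁ x - h₂ x
  have ht (x : V) : S'.T (g x) S'.one = S.T x u := by
    have := LinearMap.congr_fun hf (g x)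
    simpa [sub_eq_zero] using this
  have hσ : S'.T (S'.sharp (g x)) S'.one = S.T (S.sharp x) (S.sharp u) := by
    have e₁ := S.T_isoMul u x x
    have e₂ := S'.T_isoMul S'.one (g x) (g x)
    rw [isoMul_one, ← hg, ht, ht, sharp_one, e₁] at e₂
    simp only [X_self, map_smul, LinearMap.smul_apply, smul_eq_mul] at e₂
    refine mul_left_cancel₀ S.two_ne ?_
    linear_combination e₂
  have h := (h₁ x).symm.trans (h₂ x)
  rw [ht, hσ] at h
  refine smul_left_injective F S'.one_ne_zero ?_
  linear_combination (norm := module) -h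

end Maps

end CubicNormStructure

/-! ### The triple system of a cubic norm structure -/

namespace CubicNormStructure

variable {F : Type u} {V : Type v} [Field F] [AddCommGroup V] [Module F V]
  (S : CubicNormStructure F V)

/-- The alternating form on `F × V × V × F`. -/
def brownForm (x y : F × V × V × F) : F :=
  x.1 * y.2.2.2 - y.1 * x.2.2.2 + S.T x.2.1 y.2.2.1 - S.T y.2.1 x.2.2.1

/-- The symmetric form through which the scalars enter `brownTriple`. -/
def brownPairing (x y : F × V × V × F) : F :=
  x.1 * y.2.2.2 + y.1 * x.2.2.2 - S.T x.2.1 y.2.2.1 - S.T y.2.1 x.2.2.1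

/-- The symmetric trilinear product on `F × V × V × F`. -/
def brownTriple (x y z : F × V × V × F) : F × V × V × F :=
  (-(S.brownPairing y z * x.1 + S.brownPairing x z * y.1 + S.brownPairing x y * z.1)
      - 2 * S.T (S.X x.2.2.1 y.2.2.1) z.2.2.1,
    S.brownPairing y z • x.2.1 + S.brownPairing x z • y.2.1 + S.brownPairing x y • z.2.1
      - (2 : F) • (z.2.2.2 • S.X x.2.2.1 y.2.2.1 + y.2.2.2 • S.X x.2.2.1 z.2.2.1
        + x.2.2.2 • S.X y.2.2.1 z.2.2.1)
      + (2 : F) • (S.X (S.X x.2.1 y.2.1) z.2.2.1 + S.X (S.X x.2.1 z.2.1) y.2.2.1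
        + S.X (S.X y.2.1 z.2.1) x.2.2.1),
    -(S.brownPairing y z • x.2.2.1 + S.brownPairing x z • y.2.2.1
        + S.brownPairing x y • z.2.2.1)
      + (2 : F) • (z.1 • S.X x.2.1 y.2.1 + y.1 • S.X x.2.1 z.2.1 + x.1 • S.X y.2.1 z.2.1)
      - (2 : F) • (S.X (S.X x.2.2.1 y.2.2.1) z.2.1 + S.X (S.X x.2.2.1 z.2.2.1) y.2.1
        + S.X (S.X y.2.2.1 z.2.2.1) x.2.1),
    S.brownPairing y z * x.2.2.2 + S.brownPairing x z * y.2.2.2 + S.brownPairing x y * z.2.2.2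
      + 2 * S.T (S.X x.2.1 y.2.1) z.2.1)

/-- The cubic map `x ↦ ⅙ t(x,x,x)` of the triple system. -/
def brownCube (x : F × V × V × F) : F × V × V × F :=
  (-(x.1 * x.2.2.2 - S.T x.2.1 x.2.2.1) * x.1 - 2 * S.norm x.2.2.1,
    (x.1 * x.2.2.2 - S.T x.2.1 x.2.2.1) • x.2.1 - (2 * x.2.2.2) • S.sharp x.2.2.1
      + (2 : F) • S.X (S.sharp x.2.1) x.2.2.1,
    -(x.1 * x.2.2.2 - S.T x.2.1 x.2.2.1) • x.2.2.1 + (2 * x.1) • S.sharp x.2.1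
      - (2 : F) • S.X (S.sharp x.2.2.1) x.2.1,
    (x.1 * x.2.2.2 - S.T x.2.1 x.2.2.1) * x.2.2.2 + 2 * S.norm x.2.1)

lemma brownTriple_eq (x y z : F × V × V × F) :
    S.brownTriple x y z = S.brownCube (x + y + z) - S.brownCube (x + y) - S.brownCube (x + z)
      - S.brownCube (y + z) + S.brownCube x + S.brownCube y + S.brownCube z := by
  obtain ⟨a, j, k, b⟩ := x
  obtain ⟨a', j', k', b'⟩ := y
  obtain ⟨a'', j'', k'', b''⟩ := z
  simp only [brownTriple, brownCube, brownPairing, Prod.mk_add_mk, Prod.mk_sub_mk, Prod.mk.injEq,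
    map_add, LinearMap.add_apply, sharp_add, norm_add]
  refine ⟨?_, ?_, ?_, ?_⟩
  · ring
  · module
  · module
  · ring

lemma brownTriple_self (x : F × V × V × F) :
    S.brownTriple x x x = (6 : F) • S.brownCube x := by
  obtain ⟨a, j, k, b⟩ := x
  simp only [brownTriple, brownCube, brownPairing, X_self, Prod.smul_mk, Prod.mk.injEq,
    map_smul, LinearMap.smul_apply, T_sharp_self, smul_eq_mul]
  refine ⟨?_, ?_, ?_, ?_⟩
  · ring
  · module
  · module
  · ring

/-- Similarity of the associated triple systems, with multiplier `c`. -/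
structure IsBrownSimilarity {V' : Type w} [AddCommGroup V'] [Module F V']
    (S : CubicNormStructure F V) (S' : CubicNormStructure F V') (c : F)
    (f : (F × V × V × F) ≃ₗ[F] (F × V' × V' × F)) : Prop where
  form : ∀ x y, S'.brownForm (f x) (f y) = c * S.brownForm x y
  triple : ∀ x y z, S'.brownTriple (f x) (f y) (f z) = c • f (S.brownTriple x y z)

namespace IsBrownSimilarity

variable {V' : Type*} [AddCommGroup V'] [Module F V'] {S} {S' : CubicNormStructure F V'} {c d : F}
  {f : (F × V × V × F) ≃ₗ[F] (F × V' × V' × F)}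

lemma of_cube (hform : ∀ x y, S'.brownForm (f x) (f y) = c * S.brownForm x y)
    (hcube : ∀ x, S'.brownCube (f x) = c • f (S.brownCube x)) : IsBrownSimilarity S S' c f where
  form := hform
  triple x y z := by
    simp only [brownTriple_eq, ← map_add, hcube]
    simp only [map_add, map_sub, smul_add, smul_sub]

lemma cube (h : IsBrownSimilarity S S' c f) (x : F × V × V × F) :
    S'.brownCube (f x) = c • f (S.brownCube x) := by
  have h6 : (6 : F) ≠ 0 := by
    have := mul_ne_zero S.two_ne S.three_ne
    norm_num at this
    exact this
  have := h.triple x x x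
  rw [brownTriple_self, brownTriple_self, map_smul, smul_comm] at this
  exact smul_right_injective _ h6 this

lemma symm (h : IsBrownSimilarity S S' c f) (hc : c ≠ 0) :
    IsBrownSimilarity S' S c⁻¹ f.symm where
  form x y := by
    have := h.form (f.symm x) (f.symm y)
    simp only [LinearEquiv.apply_symm_apply] at this
    rw [this, inv_mul_cancel_left₀ hc]
  triple x y z := by
    have := h.triple (f.symm x) (f.symm y) (f.symm z)
    simp only [LinearEquiv.apply_symm_apply] at this
    rw [this, map_smul, LinearEquiv.symm_apply_apply, inv_smul_smul₀ hc]

lemma trans {V'' : Type*} [AddCommGroup V''] [Module F V''] {S'' : CubicNormStructure F V''}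
    {f' : (F × V' × V' × F) ≃ₗ[F] (F × V'' × V'' × F)} (h : IsBrownSimilarity S S' c f)
    (h' : IsBrownSimilarity S' S'' d f') : IsBrownSimilarity S S'' (d * c) (f.trans f') where
  form x y := by simp [h.form, h'.form, mul_assoc]
  triple x y z := by simp [h.triple, h'.triple, smul_smul]

end IsBrownSimilarity

/-- The linear map with `(1,0;0,0) ↦ (1, a^#; a, N(a))`. -/
def shearMap (a : V) : (F × V × V × F) →ₗ[F] (F × V × V × F) where
  toFun x := (x.1, x.2.1 + S.X a x.2.2.1 + x.1 • S.sharp a, x.2.2.1 + x.1 • a,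
    x.2.2.2 + S.T a x.2.1 + S.T (S.sharp a) x.2.2.1 + x.1 * S.norm a)
  map_add' x y := by
    simp only [Prod.fst_add, Prod.snd_add, map_add, Prod.mk_add_mk, Prod.mk.injEq, true_and]
    refine ⟨?_, ?_, ?_⟩
    · module
    · module
    · ring
  map_smul' c x := by
    simp only [Prod.smul_fst, Prod.smul_snd, map_smul, Prod.smul_mk, Prod.mk.injEq,
      RingHom.id_apply, smul_eq_mul, true_and]
    refine ⟨?_, ?_, ?_⟩
    · module
    · module
    · ring

lemma shearMap_neg_shearMap (a : V) (x : F × V × V × F) :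
    S.shearMap (-a) (S.shearMap a x) = x := by
  obtain ⟨α, j, k, β⟩ := x
  simp only [shearMap, LinearMap.coe_mk, AddHom.coe_mk, map_neg, sharp_neg, norm_neg, map_add,
    map_smul, LinearMap.neg_apply, X_self, Prod.mk.injEq, smul_eq_mul, T_sharp_self, true_and]
  have h₁ : S.T a (S.sharp a) = 3 * S.norm a := by rw [S.T_comm, T_sharp_self]
  have h₂ : S.T a (S.X a k) = 2 * S.T (S.sharp a) k := by rw [S.T_comm, T_X_left_self]
  refine ⟨?_, ?_, ?_⟩
  · module
  · module
  · rw [h₁, h₂]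
    ring

/-- The shear by `a` as a linear automorphism. -/
def shear (a : V) : (F × V × V × F) ≃ₗ[F] (F × V × V × F) :=
  LinearEquiv.ofLinearMap (S.shearMap a) (S.shearMap (-a))
    (LinearMap.ext fun x => by
      have := S.shearMap_neg_shearMap (-a) x
      rwa [neg_neg] at this)
    (LinearMap.ext fun x => S.shearMap_neg_shearMap a x)

lemma shear_apply (a : V) (α β : F) (j k : V) :
    S.shear a (α, j, k, β) = (α, j + S.X a k + α • S.sharp a, k + α • a,
      β + S.T a j + S.T (S.sharp a) k + α * S.norm a) := rfl

lemma isBrownSimilarity_shear (a : V) : IsBrownSimilarity S S 1 (S.shear a) := by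
  refine .of_cube (fun x y => ?_) (fun x => ?_)
  · obtain ⟨α, j, k, β⟩ := x
    obtain ⟨α', j', k', β'⟩ := y
    simp only [shear_apply, brownForm, map_add, map_smul, LinearMap.add_apply,
      LinearMap.smul_apply, smul_eq_mul, S.T_comm a, T_X_left_self, S.T_X_comm a k' k]
    ring
  · obtain ⟨α, j, k, β⟩ := x
    have hQ : α * (β + S.T a j + S.T (S.sharp a) k + α * S.norm a)
        - S.T (j + S.X a k + α • S.sharp a) (k + α • a)
        = α * β - S.T j k - 2 * α * S.T (S.sharp a) k - 2 * S.T (S.sharp k) a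
          - 2 * α ^ 2 * S.norm a := by
      simp only [map_add, map_smul, LinearMap.add_apply,
        LinearMap.smul_apply, smul_eq_mul, S.T_comm a, T_X_left_self, T_X_right_self, T_sharp_self]
      ring
    have hJ : S.sharp (j + S.X a k + α • S.sharp a) = S.sharp j + S.X j (S.X a k)
        + α • S.X (S.sharp a) j + (S.T (S.sharp a) k • k + S.T (S.sharp k) a • a
        - S.X (S.sharp a) (S.sharp k)) + α • (S.norm a • k + S.T (S.sharp a) k • a)
        + α ^ 2 • S.norm a • a := by
      rw [sharp_add, sharp_add, sharp_smul, sharp_sharp, sharp_X]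
      simp only [map_add, LinearMap.add_apply, map_smul, S.X_comm (S.X a k), S.X_comm j (S.sharp a),
        X_sharp_X]
      module
    have hK : S.sharp (k + α • a) = S.sharp k + α • S.X a k + α ^ 2 • S.sharp a := by
      rw [sharp_add, sharp_smul, map_smul, S.X_comm k]
    simp only [one_smul, shear_apply, brownCube, hQ, hJ, hK, Prod.mk.injEq]
    refine ⟨?_, ?_, ?_, ?_⟩
    · simp only [norm_add, norm_smul, sharp_smul, map_smul, LinearMap.smul_apply, smul_eq_mul]
      ring
    · have e₁ := S.X_X_sharp_polar k j a
      have e₂ := S.X_X_sharp_polar a j k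
      have e₃ := S.X_X_sharp a j
      have e₄ := S.X_X_sharp k (S.sharp a)
      have e₅ := S.X_X_sharp a (S.sharp k)
      simp only [map_add, map_sub, map_smul, LinearMap.add_apply, LinearMap.sub_apply,
        LinearMap.smul_apply, X_self]
      rw [S.X_comm k (S.X (S.X k a) j), S.X_comm (S.X k a) j, S.X_comm k a] at e₁
      rw [S.X_comm a (S.X (S.X a k) j), S.X_comm (S.X a k) j, S.X_comm k (S.X _ j)] at e₂
      rw [S.X_comm a (S.X _ j)] at e₃
      rw [S.X_comm k (S.X _ _), S.X_comm (S.sharp k)] at e₄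
      rw [S.X_comm a (S.X _ _)] at e₅
      rw [S.X_comm k a, S.X_comm a (S.sharp j)]
      linear_combination (norm := skip) (2 : F) • e₁ + (2 * α) • e₂ + (2 * α ^ 2) • e₃
        - (2 : F) • e₄ - (2 * α) • e₅
      rw [S.T_comm k j, S.T_comm k (S.sharp a), S.T_comm a (S.sharp k)]
      module
    · have e₁ : S.X (S.sharp k) (S.X a k) = S.norm k • a + S.T (S.sharp k) a • k := by
        rw [S.X_comm a k, X_sharp_X]
      have e₂ : S.X (S.X a k) (S.sharp a) = S.norm a • k + S.T (S.sharp a) k • a := by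
        rw [S.X_comm, X_sharp_X]
      simp only [map_add, map_smul, LinearMap.add_apply, LinearMap.smul_apply, X_self, sharp_X,
        X_sharp_X, sharp_sharp, e₁, e₂]
      rw [S.X_comm j (S.X a k), S.X_comm (S.sharp k) (S.sharp a)]
      module
    · have e₁ : S.T (S.sharp j) (S.X a k) = S.T a (S.X (S.sharp j) k) := by
        rw [S.T_comm, T_X, S.X_comm]
      have e₂ : S.T (S.X j (S.X a k)) (S.sharp a)
          = S.norm a * S.T j k + S.T (S.sharp a) k * S.T a j := by
        rw [T_X, S.X_comm _ (S.sharp a), X_sharp_X, S.T_comm a]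
        simp
      have e₃ : S.T (S.X (S.sharp a) (S.sharp k)) (S.sharp a) = 2 * S.norm a * S.T (S.sharp k) a := by
        rw [T_X_left_self, sharp_sharp, S.T_comm _ a]
        simp
        ring
      have e₄ : S.T a (S.X a k) = 2 * S.T (S.sharp a) k := by rw [S.T_comm, T_X_left_self]
      have e₅ : S.T a (S.sharp a) = 3 * S.norm a := by rw [S.T_comm, T_sharp_self]
      simp only [norm_add, norm_X, norm_smul, norm_sharp, sharp_add, sharp_smul, sharp_sharp,
        sharp_X, map_add, map_sub, map_smul, LinearMap.add_apply, LinearMap.sub_apply,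
        LinearMap.smul_apply, smul_eq_mul, e₁, e₂, e₃, e₄, e₅, S.T_X (S.sharp a),
        S.T_comm a (S.sharp k), S.T_comm k j, S.T_comm k (S.sharp a),
        S.T_comm (S.sharp j) (S.sharp a)]
      ring

end CubicNormStructure

namespace CubicNormStructure

variable {F : Type u} {V : Type v} [Field F] [AddCommGroup V] [Module F V]
  (S : CubicNormStructure F V)

/-- The linear automorphism `(α, j; k, β) ↦ (β, k; j, α)`. -/
def brownSwap (F : Type u) (V : Type v) [Field F] [AddCommGroup V] [Module F V] :
    (F × V × V × F) ≃ₗ[F] (F × V × V × F) where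
  toFun x := (x.2.2.2, x.2.2.1, x.2.1, x.1)
  invFun x := (x.2.2.2, x.2.2.1, x.2.1, x.1)
  map_add' _ _ := rfl
  map_smul' _ _ := rfl
  left_inv _ := rfl
  right_inv _ := rfl

lemma brownSwap_apply (α β : F) (j k : V) : brownSwap F V (α, j, k, β) = (β, k, j, α) := rfl

lemma isBrownSimilarity_brownSwap : IsBrownSimilarity S S (-1) (brownSwap F V) := by
  refine .of_cube (fun x y => ?_) (fun x => ?_)
  · obtain ⟨α, j, k, β⟩ := x
    obtain ⟨α', j', k', β'⟩ := y
    simp only [brownSwap_apply, brownForm]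
    rw [S.T_comm k, S.T_comm k']
    ring
  · obtain ⟨α, j, k, β⟩ := x
    simp only [brownSwap_apply, brownCube, Prod.smul_mk, Prod.mk.injEq, smul_eq_mul]
    rw [S.T_comm k]
    refine ⟨?_, ?_, ?_, ?_⟩
    · ring
    · module
    · module
    · ring

/-- The elements with `t(e,e,y) = -2b(e,y)e` for all `y`. -/
def IsBrownRankOne (e : F × V × V × F) : Prop :=
  ∀ y, S.brownTriple e e y = (-2 * S.brownForm e y) • e

lemma isBrownRankOne_left : S.IsBrownRankOne (1, 0, 0, 0) := fun ⟨α, j, k, β⟩ => by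
  simp [brownTriple, brownForm, brownPairing]
  ring

lemma isBrownRankOne_right : S.IsBrownRankOne (0, 0, 0, 1) := fun ⟨α, j, k, β⟩ => by
  simp [brownTriple, brownForm, brownPairing]
  ring

variable {S}

lemma IsBrownRankOne.map {V' : Type*} [AddCommGroup V'] [Module F V']
    {S' : CubicNormStructure F V'} {c : F} {f : (F × V × V × F) ≃ₗ[F] (F × V' × V' × F)}
    {e : F × V × V × F} (he : S.IsBrownRankOne e) (h : IsBrownSimilarity S S' c f) :
    S'.IsBrownRankOne (f e) := fun y => by
  obtain ⟨y, rfl⟩ := f.surjective y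
  rw [h.triple, he, h.form, map_smul, smul_smul]
  congr 1
  ring

/-- A rank one element with invertible first coordinate lies on the orbit of `(1,0;0,0)`
under the shears. -/
lemma IsBrownRankOne.shear_eq {α β : F} {j k : V} (he : S.IsBrownRankOne (α, j, k, β))
    (hα : α ≠ 0) : S.shear (-(α⁻¹ • k)) (α, j, k, β) = (α, 0, 0, 0) := by
  have h := he (0, 0, 0, 1)
  simp only [brownTriple, brownForm, brownPairing, Prod.smul_mk, Prod.mk.injEq, map_zero,
    LinearMap.zero_apply, X_self, smul_eq_mul] at h
  obtain ⟨-, hj, -, hβ⟩ := h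
  have h2 := S.two_ne
  have h3 := S.three_ne
  have hj' : S.sharp k = α • j := by
    refine smul_right_injective V (mul_ne_zero h2 h2) ?_
    simp only
    linear_combination (norm := module) -hj
  have hβ' : S.T j k = 3 * α * β := by
    refine mul_left_cancel₀ h2 ?_
    linear_combination -hβ
  have hN : S.norm k = α ^ 2 * β := by
    refine mul_left_cancel₀ h3 ?_
    rw [← S.T_sharp_self, hj', map_smul, LinearMap.smul_apply, hβ', smul_eq_mul]
    ring
  simp only [shear_apply, sharp_neg, sharp_smul, norm_neg, norm_smul, map_neg, map_smul,
    LinearMap.neg_apply, LinearMap.smul_apply, X_self, hj', S.T_comm k j, hβ', hN, smul_eq_mul,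
    Prod.mk.injEq, true_and]
  refine ⟨?_, ?_, ?_⟩
  · match_scalars
    field_simp
    ring
  · match_scalars
    field_simp
    ring
  · field_simp
    ring

variable (S)

lemma exists_add_T_ne_zero {α β : F} {j k : V} (h : (α, j, k, β) ≠ 0) :
    ∃ a, α + S.T a k + S.T (S.sharp a) j + β * S.norm a ≠ 0 := by
  by_contra! H
  refine h ?_
  have h2 := S.two_ne
  have h3 := S.three_ne
  have hα : α = 0 := by simpa [sharp, norm] using H 0
  subst hα
  have hq : ∀ a, S.T (S.sharp a) j = 0 := fun a => by
    have h₁ := H a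
    have h₂ := H (-a)
    simp only [map_neg, LinearMap.neg_apply, sharp_neg, norm_neg] at h₂
    refine mul_left_cancel₀ h2 ?_
    linear_combination h₁ + h₂
  have hc : ∀ a, β * S.norm a = 0 := fun a => by
    have h₁ := H a
    have h₂ := H ((2 : F) • a)
    simp only [map_smul, LinearMap.smul_apply, sharp_smul, norm_smul, smul_eq_mul, hq] at h₁ h₂
    refine mul_left_cancel₀ (mul_ne_zero h2 h3) ?_
    linear_combination h₂ - 2 * h₁
  have hβ : β = 0 := by simpa [norm_one] using hc S.one
  have hk : k = 0 := S.ext_T fun a => by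
    have h₁ := H a
    rw [hq, hc] at h₁
    simpa [S.T_comm k] using h₁
  have hX : ∀ a b, S.T (S.X a b) j = 0 := fun a b => by
    have h₁ := hq (a + b)
    simpa [sharp_add, hq] using h₁
  have hj : j = 0 := by
    have h₁ : ∀ b, S.T b S.one * S.T S.one j = S.T b j := fun b => by
      have := hX S.one b
      rw [S.X_one] at this
      simp only [map_sub, map_smul, LinearMap.sub_apply, LinearMap.smul_apply, smul_eq_mul] at this
      rw [S.T_comm b S.one]
      linear_combination this
    have h₂ : S.T S.one j = 0 := by
      have := h₁ S.one
      rw [S.T_one_one] at this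
      refine mul_left_cancel₀ h2 ?_
      linear_combination this
    refine S.ext_T fun b => ?_
    rw [S.T_comm, ← h₁, h₂]
    simp
  simp [hβ, hk, hj]

/-- Nonzero rank one elements are moved to the line of `(1,0;0,0)` by a self-similarity. -/
lemma exists_isBrownSimilarity_apply_eq {e : F × V × V × F} (he : S.IsBrownRankOne e)
    (h0 : e ≠ 0) : ∃ (f : (F × V × V × F) ≃ₗ[F] (F × V × V × F)) (c α : F),
      c ≠ 0 ∧ α ≠ 0 ∧ IsBrownSimilarity S S c f ∧ f e = (α, 0, 0, 0) := by
  obtain ⟨α, j, k, β⟩ := e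
  obtain ⟨a, ha⟩ := S.exists_add_T_ne_zero h0
  have hf := (S.isBrownSimilarity_brownSwap.trans (S.isBrownSimilarity_shear a)).trans
    S.isBrownSimilarity_brownSwap
  have hr := he.map hf
  simp only [LinearEquiv.trans_apply, brownSwap_apply, shear_apply] at hr
  have hs := hr.shear_eq ha
  refine ⟨_, _, _, ?_, ha, hf.trans (S.isBrownSimilarity_shear _), hs⟩
  norm_num

section

variable {V' : Type w} [AddCommGroup V'] [Module F V'] {S} {S' : CubicNormStructure F V'}
  {c d r : F} {f : (F × V × V × F) ≃ₗ[F] (F × V' × V' × F)}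

/-- A similarity can be adjusted so as to preserve the two outer coordinate lines. -/
lemma IsBrownSimilarity.exists_apply_eq (h : IsBrownSimilarity S S' c f) (hc : c ≠ 0) :
    ∃ (f' : (F × V × V × F) ≃ₗ[F] (F × V' × V' × F)) (c' α β : F), c' ≠ 0 ∧ α ≠ 0 ∧ β ≠ 0 ∧
      IsBrownSimilarity S S' c' f' ∧ f' (1, 0, 0, 0) = (α, 0, 0, 0) ∧
      f' (0, 0, 0, 1) = (0, 0, 0, β) := by
  obtain ⟨f₁, c₁, α, hc₁, hα, h₁, hα'⟩ :=
    S'.exists_isBrownSimilarity_apply_eq (S.isBrownRankOne_left.map h) (by simp)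
  have h₂ := h.trans h₁
  obtain ⟨⟨x, j, k, β⟩, he⟩ : ∃ e, (f.trans f₁) (0, 0, 0, 1) = e := ⟨_, rfl⟩
  have hr := S.isBrownRankOne_right.map h₂
  rw [he] at hr
  have hr' := hr.map S'.isBrownSimilarity_brownSwap
  have hβ : β ≠ 0 := by
    have := h₂.form (1, 0, 0, 0) (0, 0, 0, 1)
    rw [he, LinearEquiv.trans_apply, hα'] at this
    simp only [brownForm, map_zero, LinearMap.zero_apply] at this
    rintro rfl
    simp [hc, hc₁] at this
  refine ⟨_, _, α, β, ?_, hα, hβ, ((h₂.trans S'.isBrownSimilarity_brownSwap).trans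
    (S'.isBrownSimilarity_shear (-(β⁻¹ • j)))).trans S'.isBrownSimilarity_brownSwap, ?_, ?_⟩
  · simp [hc, hc₁]
  · rw [LinearEquiv.trans_apply, LinearEquiv.trans_apply, LinearEquiv.trans_apply,
      LinearEquiv.trans_apply, hα', brownSwap_apply, shear_apply]
    simp [brownSwap_apply]
  · rw [LinearEquiv.trans_apply, LinearEquiv.trans_apply, LinearEquiv.trans_apply, he]
    erw [hr'.shear_eq hβ]
    rfl

lemma IsBrownSimilarity.apply_left_eq (h : IsBrownSimilarity S S' r f) (hr : r ≠ 0)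
    (hc : c ≠ 0) (hd : d ≠ 0) (hfc : f (1, 0, 0, 0) = (c, 0, 0, 0))
    (hfd : f (0, 0, 0, 1) = (0, 0, 0, d)) (j : V) :
    f (0, j, 0, 0) = (0, (f (0, j, 0, 0)).2.1, 0, 0) := by
  obtain ⟨⟨x, j', k', y⟩, he⟩ : ∃ e, f (0, j, 0, 0) = e := ⟨_, rfl⟩
  have h₁ := h.form (1, 0, 0, 0) (0, j, 0, 0)
  have h₂ := h.form (0, 0, 0, 1) (0, j, 0, 0)
  have h₃ := h.form (1, 0, 0, 0) (0, 0, 0, 1)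
  have h₄ := h.triple (1, 0, 0, 0) (0, 0, 0, 1) (0, j, 0, 0)
  have h₅ : S.brownTriple (1, 0, 0, 0) (0, 0, 0, 1) (0, j, 0, 0) = (0, j, 0, 0) := by
    simp [brownTriple, brownPairing]
  rw [h₅] at h₄
  rw [hfc, he] at h₁
  rw [hfd, he] at h₂
  rw [hfc, hfd] at h₃
  rw [hfc, hfd, he] at h₄
  simp only [brownForm, map_zero, LinearMap.zero_apply] at h₁ h₂ h₃
  simp [hc] at h₁
  simp [hd] at h₂
  simp at h₃
  subst h₁ h₂ h₃
  simp [brownTriple, brownPairing] at h₄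
  rw [he]
  have : k' = 0 := by
    refine smul_right_injective V' (mul_ne_zero S.two_ne hr) ?_
    simp only
    linear_combination (norm := module) -h₄
  simp [this]

/-- Similar triple systems come from cubic norm structures with similar norms. -/
theorem IsBrownSimilarity.exists_norm_similarity (h : IsBrownSimilarity S S' c f) (hc : c ≠ 0) :
    ∃ (g : V ≃ₗ[F] V') (μ : F), μ ≠ 0 ∧ ∀ x, S'.norm (g x) = μ * S.norm x := by
  obtain ⟨f, c, α, β, hc, hα, hβ, h, hfα, hfβ⟩ := h.exists_apply_eq hc
  have hf := h.apply_left_eq hc hα hβ hfα hfβ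
  have hf' := (h.symm hc).apply_left_eq (inv_ne_zero hc) (inv_ne_zero hα) (inv_ne_zero hβ)
    (by
      rw [LinearEquiv.symm_apply_eq, eq_comm]
      have := congrArg (α⁻¹ • ·) hfα
      simpa [← map_smul, hα] using this)
    (by
      rw [LinearEquiv.symm_apply_eq, eq_comm]
      have := congrArg (β⁻¹ • ·) hfβ
      simpa [← map_smul, hβ] using this)
  refine ⟨LinearEquiv.ofLinearMap
    (LinearMap.fst F V' (V' × F) ∘ₗ LinearMap.snd F F _ ∘ₗ f.toLinearMap ∘ₗ LinearMap.inr F F _ ∘ₗ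
      LinearMap.inl F V (V × F))
    (LinearMap.fst F V (V × F) ∘ₗ LinearMap.snd F F _ ∘ₗ f.symm.toLinearMap ∘ₗ
      LinearMap.inr F F _ ∘ₗ LinearMap.inl F V' (V' × F))
    (LinearMap.ext fun x => ?_) (LinearMap.ext fun x => ?_), c * β, mul_ne_zero hc hβ, fun x => ?_⟩
  · change (f (0, (f.symm (0, x, 0, 0)).2.1, 0, 0)).2.1 = x
    rw [← hf', LinearEquiv.apply_symm_apply]
  · change (f.symm (0, (f (0, x, 0, 0)).2.1, 0, 0)).2.1 = x
    rw [← hf, LinearEquiv.symm_apply_apply]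
  · change S'.norm (f (0, x, 0, 0)).2.1 = _
    have h₁ := h.cube (0, x, 0, 0)
    have h₂ : S.brownCube (0, x, 0, 0) = (2 * S.norm x) • (0, 0, 0, 1) := by
      simp [brownCube, sharp, norm]
    rw [h₂, map_smul, hfβ, hf] at h₁
    have h₃ := congrArg (fun z => z.2.2.2) h₁
    simp only [brownCube, map_zero, mul_zero, zero_add, Prod.smul_mk, smul_eq_mul] at h₃
    refine mul_left_cancel₀ S.two_ne ?_
    linear_combination h₃

/-- A norm similarity `g` with inverse adjoint `g'` induces a similarity of triple systems. -/
theorem exists_isBrownSimilarity_of_norm {μ : F} {g g' : V ≃ₗ[F] V'} (hμ : μ ≠ 0)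
    (hN : ∀ x, S'.norm (g x) = μ * S.norm x) (hT : ∀ x y, S'.T (g x) (g' y) = S.T x y) :
    ∃ f, IsBrownSimilarity S S' 1 f := by
  refine ⟨(LinearEquiv.smulOfNeZero F F μ⁻¹ (inv_ne_zero hμ)).prodCongr
    (g.prodCongr (g'.prodCongr (LinearEquiv.smulOfNeZero F F μ hμ))),
    .of_cube (fun x y => ?_) fun x => ?_⟩
  · obtain ⟨α, j, k, β⟩ := x
    obtain ⟨α', j', k', β'⟩ := y
    simp [brownForm, hT]
    field_simp
  · obtain ⟨α, j, k, β⟩ := x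
    have h₁ := sharp_map (g' := g'.toLinearMap) hN hT
    have h₂ := sharp_map_dual (g' := g'.toLinearMap) hN hT hμ
    have h₃ := X_map_of_sharp_map (g := g.toLinearMap) h₁
    have h₄ := X_map_of_sharp_map (g' := g.toLinearMap) h₂
    have h₅ : S'.norm (g' k) = μ⁻¹ * S.norm k := by
      refine mul_left_cancel₀ S.three_ne ?_
      have := h₂ k
      simp only [LinearEquiv.coe_coe] at this
      rw [← S'.T_sharp_self, this, map_smul, LinearMap.smul_apply, hT, T_sharp_self, smul_eq_mul]
      ring
    simp only [LinearEquiv.coe_coe] at h₁ h₂ h₃ h₄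
    simp only [LinearEquiv.prodCongr_apply, brownCube, LinearEquiv.smulOfNeZero_apply,
      one_smul, Prod.mk.injEq, smul_eq_mul, hT, hN, h₁, h₂, h₃, h₄, h₅, map_add, map_sub,
      map_smul, LinearMap.smul_apply, smul_smul]
    refine ⟨?_, ?_, ?_, ?_⟩
    · field_simp
    · match_scalars <;> field_simp
    · match_scalars <;> field_simp
    · field_simp

end

end CubicNormStructure

namespace CubicNormStructure

variable {F : Type u} {V : Type v} {V' : Type w} [Field F] [AddCommGroup V] [Module F V]
  [AddCommGroup V'] [Module F V'] {S : CubicNormStructure F V} {S' : CubicNormStructure F V'}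

/-- The inverse adjoint of a linear equivalence with respect to the trace forms. -/
lemma exists_T_apply_apply_eq [FiniteDimensional F V] (g : V ≃ₗ[F] V') :
    ∃ g' : V ≃ₗ[F] V', ∀ x y, S'.T (g x) (g' y) = S.T x y := by
  have := Module.Finite.equiv g
  have hinj : Function.Injective S.T := fun x y h => sub_eq_zero.1 <| S.T_nondeg _ fun z => by
    rw [map_sub, h, sub_self, LinearMap.zero_apply]
  have hinj' : Function.Injective S'.T := fun x y h => sub_eq_zero.1 <| S'.T_nondeg _ fun z => by
    rw [map_sub, h, sub_self, LinearMap.zero_apply]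
  let e := LinearEquiv.ofInjectiveOfFinrankEq S.T hinj Subspace.dual_finrank_eq.symm
  let e' := LinearEquiv.ofInjectiveOfFinrankEq S'.T hinj' Subspace.dual_finrank_eq.symm
  refine ⟨e.trans (g.symm.dualMap.trans e'.symm), fun x y => ?_⟩
  have h : e' (e'.symm (g.symm.dualMap (e y))) = g.symm.dualMap (e y) := e'.apply_symm_apply _
  have h' := LinearMap.congr_fun h (g x)
  rw [LinearEquiv.dualMap_apply, g.symm_apply_apply] at h'
  rw [S'.T_comm, S.T_comm]
  exact h'

/-- The triple systems of two cubic norm structures are similar if and only if the corresponding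
Jordan algebras are isotopic. -/
theorem exists_isBrownSimilarity_iff_isotopic [FiniteDimensional F V]
    (hcub : ∀ f : V' →ₗ[F] F, (∀ y, ∃ a b : F, f y • S'.jmul y y = a • y + b • S'.one) → f = 0) :
    (∃ (c : F) (f : (F × V × V × F) ≃ₗ[F] (F × V' × V' × F)), c ≠ 0 ∧ IsBrownSimilarity S S' c f) ↔
      ∃ u, S.norm u ≠ 0 ∧ ∃ g : V ≃ₗ[F] V', ∀ x y, g (S.isoMul u x y) = S'.jmul (g x) (g y) := by
  constructor
  · rintro ⟨c, f, hc, h⟩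
    obtain ⟨g, μ, hμ, hN⟩ := h.exists_norm_similarity hc
    obtain ⟨g', hT⟩ := exists_T_apply_apply_eq (S := S) (S' := S') g
    obtain ⟨u, hu, hg⟩ := exists_isotope_of_norm_similarity (g' := g'.toLinearMap) hN hT hμ
    exact ⟨u, hu, g, hg⟩
  · rintro ⟨u, hu, g, hg⟩
    obtain ⟨g', hT⟩ := exists_T_apply_apply_eq (S := S) (S' := S') g
    obtain ⟨f, hf⟩ := exists_isBrownSimilarity_of_norm hu (norm_map_of_isotope hcub hg) hT
    exact ⟨1, f, _root_.one_ne_zero, hf⟩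

end CubicNormStructure

namespace OctonionAlgebra

variable {F : Type u} [Field F] (O : OctonionAlgebra.{u, v} F)

/-- The polar form of the norm. -/
def dot : O.C →ₗ[F] O.C →ₗ[F] F := O.n.polarBilin

lemma conj_eq (x : O.C) : O.conj x = O.dot x 1 • (1 : O.C) - x := rfl

lemma n_add (x y : O.C) : O.n (x + y) = O.n x + O.n y + O.dot x y := QuadraticMap.map_add O.n x y

lemma n_smul (r : F) (x : O.C) : O.n (r • x) = r ^ 2 * O.n x := by
  rw [QuadraticMap.map_smul, smul_eq_mul, sq]

lemma dot_comm (x y : O.C) : O.dot x y = O.dot y x := QuadraticMap.polar_comm O.n x y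

lemma dot_self (x : O.C) : O.dot x x = 2 * O.n x := by
  simp [dot]

lemma ext_dot {x y : O.C} (h : ∀ z, O.dot x z = O.dot y z) : x = y :=
  sub_eq_zero.1 <| O.nondeg _ fun z => by
    change O.dot (x - y) z = 0
    rw [map_sub, LinearMap.sub_apply, h, sub_self]

lemma dot_one_one : O.dot 1 1 = 2 := by rw [dot_self, O.n_one, mul_one]

lemma dot_mul_left (x y z : O.C) : O.dot (x * y) (x * z) = O.n x * O.dot y z := by
  have h := O.n_mul x (y + z)
  rw [mul_add, n_add, n_add, O.n_mul, O.n_mul] at h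
  linear_combination h

lemma dot_mul_right (x y z : O.C) : O.dot (x * z) (y * z) = O.dot x y * O.n z := by
  have h := O.n_mul (x + y) z
  rw [add_mul, n_add, n_add, O.n_mul, O.n_mul] at h
  linear_combination h

lemma dot_mul_mul (x y z w : O.C) :
    O.dot (x * y) (z * w) + O.dot (x * w) (z * y) = O.dot x z * O.dot y w := by
  have h := O.dot_mul_left (x + z) y w
  simp only [add_mul, map_add, LinearMap.add_apply, dot_mul_left, n_add] at h
  rw [O.dot_comm (z * y)] at h
  linear_combination h

lemma dot_mul_eq_left (x y z : O.C) : O.dot (x * y) z = O.dot y (O.conj x * z) := by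
  have h := O.dot_mul_mul x y 1 z
  rw [one_mul, one_mul, O.dot_comm (x * z)] at h
  rw [conj_eq, sub_mul, smul_mul_assoc, one_mul, map_sub, map_smul, smul_eq_mul]
  linear_combination h

lemma dot_mul_eq_right (x y z : O.C) : O.dot (x * y) z = O.dot x (z * O.conj y) := by
  have h := O.dot_mul_mul x y z 1
  rw [mul_one, mul_one] at h
  rw [conj_eq, mul_sub, mul_smul_comm, mul_one, map_sub, map_smul, smul_eq_mul]
  linear_combination h

lemma conj_conj (x : O.C) : O.conj (O.conj x) = x := by
  simp only [conj_eq, map_sub, map_smul, dot_one_one]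
  module

lemma conj_one : O.conj 1 = 1 := by
  rw [conj_eq, dot_one_one]
  module

lemma dot_conj_conj (x y : O.C) : O.dot (O.conj x) (O.conj y) = O.dot x y := by
  simp only [conj_eq, map_sub, map_smul, LinearMap.sub_apply, LinearMap.smul_apply, dot_one_one,
    smul_eq_mul, O.dot_comm 1]
  ring

lemma dot_conj_left (x y : O.C) : O.dot (O.conj x) y = O.dot x (O.conj y) := by
  rw [← dot_conj_conj, conj_conj]

lemma conj_mul (x y : O.C) : O.conj (x * y) = O.conj y * O.conj x := O.ext_dot fun z => by
  rw [dot_conj_left, dot_mul_eq_left, dot_mul_eq_left, conj_conj, O.dot_comm _ (y * z),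
    dot_mul_eq_right]

lemma conj_mul_mul (x y : O.C) : O.conj x * (x * y) = O.n x • y := O.ext_dot fun z => by
  rw [dot_mul_eq_left, conj_conj, dot_mul_left, map_smul, LinearMap.smul_apply, smul_eq_mul]

lemma mul_mul_conj (x y : O.C) : y * x * O.conj x = O.n x • y := O.ext_dot fun z => by
  rw [dot_mul_eq_right, conj_conj, dot_mul_right, map_smul, LinearMap.smul_apply, smul_eq_mul,
    mul_comm]

lemma mul_conj_self (x : O.C) : x * O.conj x = O.n x • (1 : O.C) := by
  simpa using O.mul_mul_conj x 1

lemma conj_mul_self (x : O.C) : O.conj x * x = O.n x • (1 : O.C) := by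
  simpa using O.conj_mul_mul x 1

lemma n_conj (x : O.C) : O.n (O.conj x) = O.n x := by
  rw [conj_eq, sub_eq_add_neg, n_add, n_smul, O.n_one, QuadraticMap.map_neg, map_neg, map_smul,
    LinearMap.smul_apply, O.dot_comm 1, smul_eq_mul]
  ring

lemma dot_mul_one_comm (x y : O.C) : O.dot (x * y) 1 = O.dot (y * x) 1 := by
  rw [dot_mul_eq_left, mul_one, dot_mul_eq_right, one_mul]

lemma dot_mul_mul_one (x y z : O.C) : O.dot (x * y * z) 1 = O.dot (x * (y * z)) 1 := by
  rw [dot_mul_eq_right, one_mul, dot_mul_eq_right, dot_mul_eq_right, one_mul, conj_mul]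

lemma dot_conj_mul_cyclic (x y z : O.C) :
    O.dot x (O.conj (y * z)) = O.dot y (O.conj (z * x)) := by
  rw [← dot_conj_left, O.dot_comm, dot_mul_eq_right, conj_mul]

/-- The middle Moufang identity, in terms of the norm form. -/
lemma mul_mul_mul_self (x y z : O.C) :
    x * y * (z * x) = O.dot x (O.conj (y * z)) • x - O.n x • O.conj (y * z) := by
  refine O.ext_dot fun w => ?_
  have h := O.dot_mul_mul x y w (O.conj (z * x))
  rw [dot_mul_eq_right (x := x * y), map_sub, LinearMap.sub_apply, map_smul, map_smul,
    LinearMap.smul_apply, LinearMap.smul_apply, smul_eq_mul, smul_eq_mul]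
  have h' : x * O.conj (z * x) = O.n x • O.conj z := by
    have := O.conj_mul_mul (O.conj x) (O.conj z)
    rwa [conj_conj, n_conj, ← conj_mul] at this
  rw [h', ← O.dot_conj_mul_cyclic, map_smul, LinearMap.smul_apply, smul_eq_mul,
    O.dot_comm (O.conj z), dot_mul_eq_right (x := w), ← conj_mul, O.dot_comm w] at h
  linear_combination h

end OctonionAlgebra

namespace ReducedAlbert

variable {F : Type u} [Field F] (A : ReducedAlbert.{u, v} F)

lemma trace_eq (x : A.M) : A.trace x = (2 : F)⁻¹ * ∑ i, A.O.dot (x i i) 1 := rfl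

lemma trace_add (x y : A.M) : A.trace (x + y) = A.trace x + A.trace y := by
  simp only [trace_eq, Matrix.add_apply, map_add, LinearMap.add_apply, Finset.sum_add_distrib]
  ring

lemma trace_smul (r : F) (x : A.M) : A.trace (r • x) = r * A.trace x := by
  simp only [trace_eq, Matrix.smul_apply, map_smul, LinearMap.smul_apply, smul_eq_mul,
    ← Finset.mul_sum]
  ring

lemma trace_one (h2 : (2 : F) ≠ 0) : A.trace 1 = 3 := by
  simp only [trace_eq, Matrix.one_apply_eq, OctonionAlgebra.dot_one_one, Fin.sum_univ_three]
  field_simp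
  norm_num

lemma trace_mul_comm (x y : A.M) : A.trace (x * y) = A.trace (y * x) := by
  simp only [trace_eq, Matrix.mul_apply, map_sum, LinearMap.sum_apply]
  rw [Finset.sum_comm]
  simp only [A.O.dot_mul_one_comm (y _ _)]

lemma trace_mul_assoc (x y z : A.M) : A.trace (x * y * z) = A.trace (x * (y * z)) := by
  simp only [trace_eq, Matrix.mul_apply, Finset.sum_mul, Finset.mul_sum, map_sum,
    LinearMap.sum_apply, A.O.dot_mul_mul_one]
  refine Finset.sum_congr rfl fun i _ => ?_
  rw [Finset.sum_comm]

/-- The Jordan product as a bilinear map. -/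
def jmulLin : A.M →ₗ[F] A.M →ₗ[F] A.M :=
  LinearMap.mk₂ F A.jmul
    (fun x y z => by simp only [jmul, add_mul, mul_add]; module)
    (fun r x y => by simp only [jmul, smul_mul_assoc, mul_smul_comm]; module)
    (fun x y z => by simp only [jmul, add_mul, mul_add]; module)
    (fun r x y => by simp only [jmul, smul_mul_assoc, mul_smul_comm]; module)

/-- The trace form as a bilinear map. -/
def tbLin : A.M →ₗ[F] A.M →ₗ[F] F :=
  LinearMap.mk₂ F A.tb
    (fun x y z => by simp only [tb, jmul, add_mul, mul_add, trace_add, trace_smul]; ring)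
    (fun r x y => by
      simp only [tb, jmul, smul_mul_assoc, mul_smul_comm, trace_add, trace_smul, smul_eq_mul]; ring)
    (fun x y z => by simp only [tb, jmul, add_mul, mul_add, trace_add, trace_smul]; ring)
    (fun r x y => by
      simp only [tb, jmul, smul_mul_assoc, mul_smul_comm, trace_add, trace_smul, smul_eq_mul]; ring)

lemma jmulLin_apply (x y : A.M) : A.jmulLin x y = A.jmul x y := rfl

lemma tbLin_apply (x y : A.M) : A.tbLin x y = A.tb x y := rfl

lemma jmul_comm (x y : A.M) : A.jmul x y = A.jmul y x := by
  rw [jmul, jmul, add_comm]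

lemma tb_comm (x y : A.M) : A.tb x y = A.tb y x := by
  rw [tb, tb, jmul_comm]

variable {A} in
lemma one_jmul (h2 : (2 : F) ≠ 0) (x : A.M) : A.jmul 1 x = x := by
  rw [jmul, one_mul, mul_one, ← two_smul F x, inv_smul_smul₀ h2]

variable {A} in
lemma tb_eq_trace_mul (h2 : (2 : F) ≠ 0) (x y : A.M) : A.tb x y = A.trace (x * y) := by
  rw [tb, jmul, trace_smul, trace_add, A.trace_mul_comm y x]
  field_simp
  ring

variable {A} in
lemma tb_one (h2 : (2 : F) ≠ 0) (x : A.M) : A.tb x 1 = A.trace x := by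
  rw [tb_eq_trace_mul h2, mul_one]

variable {A} in
lemma tb_jmul (h2 : (2 : F) ≠ 0) (x y z : A.M) : A.tb (A.jmul x y) z = A.tb x (A.jmul y z) := by
  rw [tb_eq_trace_mul h2, tb_eq_trace_mul h2, jmul, jmul, smul_mul_assoc, mul_smul_comm,
    trace_smul, trace_smul, add_mul, mul_add, trace_add, trace_add, trace_mul_assoc,
    A.trace_mul_assoc y, A.trace_mul_comm y, A.trace_mul_assoc x z y]

lemma sharp_eq (x : A.M) : A.sharp x = A.jmulLin x x - A.trace x • x
    + ((2 : F)⁻¹ * (A.trace x ^ 2 - A.tbLin x x)) • (1 : A.M) := rfl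

variable {A} in
lemma cross_eq (h2 : (2 : F) ≠ 0) (x y : A.M) : A.cross x y = (2 : F) • A.jmul x y
    - A.trace x • y - A.trace y • x + (A.trace x * A.trace y - A.tb x y) • (1 : A.M) := by
  simp only [cross, sharp_eq, map_add, LinearMap.add_apply, trace_add]
  simp only [jmulLin_apply, tbLin_apply, A.jmul_comm y x, A.tb_comm y x]
  match_scalars <;> field_simp <;> ring

/-- The Freudenthal product as a bilinear map. -/
def crossLin (h2 : (2 : F) ≠ 0) : A.M →ₗ[F] A.M →ₗ[F] A.M :=
  LinearMap.mk₂ F A.cross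
    (fun x y z => by
      simp only [cross_eq h2, ← jmulLin_apply, ← tbLin_apply, map_add, LinearMap.add_apply,
        trace_add]
      module)
    (fun r x y => by
      simp only [cross_eq h2, ← jmulLin_apply, ← tbLin_apply, map_smul, LinearMap.smul_apply,
        trace_smul, smul_eq_mul]
      module)
    (fun x y z => by
      simp only [cross_eq h2, ← jmulLin_apply, ← tbLin_apply, map_add, trace_add]
      module)
    (fun r x y => by
      simp only [cross_eq h2, ← jmulLin_apply, ← tbLin_apply, map_smul, trace_smul, smul_eq_mul]
      module)

lemma crossLin_apply (h2 : (2 : F) ≠ 0) (x y : A.M) : A.crossLin h2 x y = A.cross x y := rfl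

lemma cross_comm (x y : A.M) : A.cross x y = A.cross y x := by
  rw [cross, cross, add_comm x y]
  abel

variable {A} in
lemma cross_self (h2 : (2 : F) ≠ 0) (x : A.M) : A.cross x x = (2 : F) • A.sharp x := by
  rw [cross_eq h2, sharp_eq, jmulLin_apply, tbLin_apply]
  match_scalars <;> field_simp
  ring

variable {A} in
lemma tb_cross (h2 : (2 : F) ≠ 0) (x y z : A.M) :
    A.tb (A.cross x y) z = A.tb x (A.cross y z) := by
  have h1 : A.tbLin 1 z = A.trace z := by rw [tbLin_apply, tb_comm, tb_one h2]
  have h1' : A.tbLin x 1 = A.trace x := tb_one h2 x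
  have h := tb_jmul h2 x y z
  rw [← tbLin_apply, ← tbLin_apply] at h ⊢
  simp only [cross_eq h2, map_add, map_sub, map_smul, LinearMap.add_apply, LinearMap.sub_apply,
    LinearMap.smul_apply, h, h1, h1', tbLin_apply, smul_eq_mul]
  ring

variable {A} in
lemma one_cross (h2 : (2 : F) ≠ 0) (x : A.M) : A.cross 1 x = A.trace x • (1 : A.M) - x := by
  rw [cross_eq h2, one_jmul h2, A.trace_one h2, A.tb_comm, tb_one h2]
  module

lemma one_mem_J : (1 : A.M) ∈ A.J := fun i j => by
  obtain rfl | h := eq_or_ne i j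
  · simp [OctonionAlgebra.conj_one]
  · simp [Matrix.one_apply_ne h, Matrix.one_apply_ne h.symm]

variable {A}

lemma mul_apply_of_mem_J {x y : A.M} (hx : x ∈ A.J) (hy : y ∈ A.J) (i j : Fin 3) :
    (y * x) i j = ((A.γ i : F)⁻¹ * (A.γ j : F)) • A.O.conj ((x * y) j i) := by
  simp only [Matrix.mul_apply, map_sum, OctonionAlgebra.conj_mul, Finset.smul_sum]
  refine Finset.sum_congr rfl fun k _ => ?_
  rw [hx k j, hy i k, smul_mul_smul_comm]
  congr 1
  have := (A.γ k).ne_zero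
  field_simp

lemma jmul_mem_J {x y : A.M} (hx : x ∈ A.J) (hy : y ∈ A.J) : A.jmul x y ∈ A.J := by
  refine A.J.smul_mem _ fun i j => ?_
  rw [Matrix.add_apply, Matrix.add_apply, map_add, smul_add, mul_apply_of_mem_J hx hy,
    mul_apply_of_mem_J hy hx, add_comm]

lemma cross_mem_J (h2 : (2 : F) ≠ 0) {x y : A.M} (hx : x ∈ A.J) (hy : y ∈ A.J) :
    A.cross x y ∈ A.J := by
  rw [cross_eq h2]
  exact A.J.add_mem (A.J.sub_mem (A.J.sub_mem (A.J.smul_mem _ (jmul_mem_J hx hy))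
    (A.J.smul_mem _ hy)) (A.J.smul_mem _ hx)) (A.J.smul_mem _ A.one_mem_J)

lemma elt_mem_J (ε : Fin 3 → F) (a b c : A.O.C) : A.elt ε a b c ∈ A.J := fun i j => by
  have h := fun i => (A.γ i).ne_zero
  fin_cases i <;> fin_cases j <;>
    simp [elt, OctonionAlgebra.conj_conj, OctonionAlgebra.conj_one, smul_smul, h]
  all_goals
    rw [eq_comm]
    convert one_smul F _
    field_simp [h]

lemma exists_eq_elt (h2 : (2 : F) ≠ 0) {x : A.M} (hx : x ∈ A.J) :
    ∃ ε a b c, x = A.elt ε a b c := by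
  have hd : ∀ i, x i i = ((2 : F)⁻¹ * A.O.dot (x i i) 1) • (1 : A.O.C) := fun i => by
    have h := hx i i
    rw [inv_mul_cancel₀ (A.γ i).ne_zero, one_smul, OctonionAlgebra.conj_eq, eq_sub_iff_add_eq,
      ← two_smul F] at h
    rw [mul_smul, ← h, inv_smul_smul₀ h2]
  refine ⟨fun i => (2 : F)⁻¹ * A.O.dot (x i i) 1, x 1 2, x 2 0, x 0 1, ?_⟩
  ext i j
  fin_cases i <;> fin_cases j
  · exact hd 0
  · rfl
  · exact hx 0 2
  · exact hx 1 0
  · exact hd 1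
  · rfl
  · rfl
  · exact hx 2 1
  · exact hd 2

lemma trace_elt (h2 : (2 : F) ≠ 0) (ε : Fin 3 → F) (a b c : A.O.C) :
    A.trace (A.elt ε a b c) = ε 0 + ε 1 + ε 2 := by
  simp [trace_eq, elt, Fin.sum_univ_three, OctonionAlgebra.dot_one_one]
  field_simp

lemma tb_elt (h2 : (2 : F) ≠ 0) (ε ε' : Fin 3 → F) (a b c a' b' c' : A.O.C) :
    A.tb (A.elt ε a b c) (A.elt ε' a' b' c') = ε 0 * ε' 0 + ε 1 * ε' 1 + ε 2 * ε' 2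
      + (A.γ 2 : F)⁻¹ * A.γ 1 * A.O.dot a a' + (A.γ 0 : F)⁻¹ * A.γ 2 * A.O.dot b b'
      + (A.γ 1 : F)⁻¹ * A.γ 0 * A.O.dot c c' := by
  have h₁ : ∀ x y, A.O.dot (x * A.O.conj y) 1 = A.O.dot x y := fun x y => by
    rw [OctonionAlgebra.dot_mul_eq_right, OctonionAlgebra.conj_conj, one_mul]
  have h₂ : ∀ x y, A.O.dot (A.O.conj x * y) 1 = A.O.dot x y := fun x y => by
    rw [OctonionAlgebra.dot_mul_one_comm, h₁, OctonionAlgebra.dot_comm]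
  rw [tb_eq_trace_mul h2]
  simp [trace_eq, elt, Fin.sum_univ_three, mul_smul_comm, h₁, h₂,
    OctonionAlgebra.dot_one_one]
  field_simp
  ring

lemma ext_of_mem_J {x y : A.M} (hx : x ∈ A.J) (hy : y ∈ A.J) (hd : ∀ i, x i i = y i i)
    (ho : ∀ i, x i (i + 1) = y i (i + 1)) : x = y := by
  have ho' : ∀ i, x (i + 1) i = y (i + 1) i := fun i => by rw [hx, hy, ho]
  ext i j
  fin_cases i <;> fin_cases j
  · exact hd 0
  · exact ho 0
  · exact ho' 2
  · exact ho' 0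
  · exact hd 1
  · exact ho 1
  · exact ho 2
  · exact ho' 1
  · exact hd 2

lemma sharp_mem_J {x : A.M} (hx : x ∈ A.J) : A.sharp x ∈ A.J :=
  A.J.add_mem (A.J.sub_mem (jmul_mem_J hx hx) (A.J.smul_mem _ hx)) (A.J.smul_mem _ A.one_mem_J)

lemma sharp_elt (h2 : (2 : F) ≠ 0) (ε : Fin 3 → F) (a b c : A.O.C) :
    A.sharp (A.elt ε a b c) = A.elt
      ![ε 1 * ε 2 - (A.γ 2 : F)⁻¹ * A.γ 1 * A.O.n a, ε 2 * ε 0 - (A.γ 0 : F)⁻¹ * A.γ 2 * A.O.n b,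
        ε 0 * ε 1 - (A.γ 1 : F)⁻¹ * A.γ 0 * A.O.n c]
      (((A.γ 1 : F)⁻¹ * A.γ 2) • A.O.conj (b * c) - ε 0 • a)
      (((A.γ 2 : F)⁻¹ * A.γ 0) • A.O.conj (c * a) - ε 1 • b)
      (((A.γ 0 : F)⁻¹ * A.γ 1) • A.O.conj (a * b) - ε 2 • c) := by
  have h := fun i => (A.γ i).ne_zero
  refine ext_of_mem_J (sharp_mem_J (elt_mem_J ε a b c)) (elt_mem_J _ _ _ _) (fun i => ?_) fun i => ?_
  · fin_cases i <;>
    · simp only [sharp, trace_elt h2, tb_elt h2, OctonionAlgebra.dot_self]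
      simp [elt, jmul, mul_smul_comm,
        OctonionAlgebra.mul_conj_self, OctonionAlgebra.conj_mul_self]
      match_scalars
      field_simp [h]
      ring
  · fin_cases i <;>
    · simp only [sharp, trace_elt h2, tb_elt h2, OctonionAlgebra.dot_self]
      simp [elt, jmul, mul_smul_comm,
        OctonionAlgebra.conj_mul]
      match_scalars <;> field_simp [h] <;> ring

end ReducedAlbert

namespace ReducedAlbert

variable {F : Type u} [Field F] {A : ReducedAlbert.{u, v} F}

lemma elt_add (ε ε' : Fin 3 → F) (a b c a' b' c' : A.O.C) :
    A.elt ε a b c + A.elt ε' a' b' c' = A.elt (ε + ε') (a + a') (b + b') (c + c') := by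
  ext i j
  fin_cases i <;> fin_cases j <;> simp [elt, add_smul, smul_add]

lemma smul_elt (r : F) (ε : Fin 3 → F) (a b c : A.O.C) :
    r • A.elt ε a b c = A.elt (r • ε) (r • a) (r • b) (r • c) := by
  ext i j
  fin_cases i <;> fin_cases j <;> simp [elt, smul_smul, smul_comm r, mul_comm r]

lemma sharp_sharp_elt (h2 : (2 : F) ≠ 0) (ε : Fin 3 → F) (a b c : A.O.C) :
    A.sharp (A.sharp (A.elt ε a b c)) = (ε 0 * ε 1 * ε 2
      - ε 0 * ((A.γ 2 : F)⁻¹ * A.γ 1 * A.O.n a) - ε 1 * ((A.γ 0 : F)⁻¹ * A.γ 2 * A.O.n b)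
      - ε 2 * ((A.γ 1 : F)⁻¹ * A.γ 0 * A.O.n c) + A.O.dot a (A.O.conj (b * c)))
        • A.elt ε a b c := by
  have h := fun i => (A.γ i).ne_zero
  have h₀ := h 0
  have h₁ := h 1
  have h₂ := h 2
  have ha := A.O.dot_conj_mul_cyclic a b c
  have hb := A.O.dot_conj_mul_cyclic b c a
  have n_sub : ∀ (r s : F) (x y : A.O.C), A.O.n (r • x - s • y)
      = r ^ 2 * A.O.n x + s ^ 2 * A.O.n y - r * s * A.O.dot y x := fun r s x y => by
    rw [sub_eq_add_neg, ← neg_smul, A.O.n_add, A.O.n_smul, A.O.n_smul, map_smul, map_smul,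
      LinearMap.smul_apply, A.O.dot_comm y, smul_eq_mul, smul_eq_mul]
    ring
  have off : ∀ (r s t u : F) (x y z : A.O.C), A.O.conj ((r • A.O.conj (z * x) - s • y)
      * (t • A.O.conj (x * y) - u • z)) = (r * t * A.O.dot x (A.O.conj (y * z))
        - s * t * A.O.n y - r * u * A.O.n z) • x
        + (s * u - r * t * A.O.n x) • A.O.conj (y * z) := fun r s t u x y z => by
    have e₁ := A.O.mul_mul_mul_self x y z
    have e₂ := A.O.conj_mul_mul z x
    have e₃ := A.O.mul_mul_conj y x
    simp only [mul_sub, sub_mul, mul_smul_comm, smul_mul_assoc, map_sub, map_smul]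
    rw [A.O.conj_mul (A.O.conj (z * x)) (A.O.conj (x * y)), A.O.conj_conj, A.O.conj_conj, e₁,
      A.O.conj_mul (A.O.conj (z * x)) z, A.O.conj_conj, e₂,
      A.O.conj_mul y (A.O.conj (x * y)), A.O.conj_conj, e₃]
    module
  rw [sharp_elt h2, sharp_elt h2, smul_elt]
  simp only [Matrix.cons_val_zero, Matrix.cons_val_one, Matrix.cons_val, off]
  congr 1
  · ext i
    fin_cases i <;>
    · simp only [n_sub, A.O.n_conj, A.O.n_mul, Pi.smul_apply, smul_eq_mul, Fin.zero_eta,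
        Fin.mk_one, Fin.reduceFinMk, Matrix.cons_val_zero, Matrix.cons_val_one, Matrix.cons_val,
        ha, hb]
      field_simp
      ring
  · match_scalars <;> field_simp <;> ring
  · rw [ha]
    match_scalars <;> field_simp <;> ring
  · rw [ha, hb]
    match_scalars <;> field_simp <;> ring

lemma eq_zero_of_tb_eq_zero (h2 : (2 : F) ≠ 0) {x : A.M} (hx : x ∈ A.J)
    (h : ∀ y ∈ A.J, A.tb x y = 0) : x = 0 := by
  obtain ⟨ε, a, b, c, rfl⟩ := exists_eq_elt h2 hx
  have hγ := fun i => (A.γ i).ne_zero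
  have H := fun ε' a' b' c' => h _ (elt_mem_J ε' a' b' c')
  simp only [tb_elt h2] at H
  have h₀ : ε 0 = 0 := by simpa using H ![1, 0, 0] 0 0 0
  have h₁ : ε 1 = 0 := by simpa using H ![0, 1, 0] 0 0 0
  have h₂ : ε 2 = 0 := by simpa using H ![0, 0, 1] 0 0 0
  have ha : a = 0 := A.O.ext_dot fun z => by simpa [hγ] using H 0 z 0 0
  have hb : b = 0 := A.O.ext_dot fun z => by simpa [hγ] using H 0 0 z 0
  have hc : c = 0 := A.O.ext_dot fun z => by simpa [hγ] using H 0 0 0 z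
  ext i j
  fin_cases i <;> fin_cases j <;> simp [elt, h₀, h₁, h₂, ha, hb, hc]

lemma sharp_sharp (h2 : (2 : F) ≠ 0) {x : A.M} (hx : x ∈ A.J) :
    (3 : F) • A.sharp (A.sharp x) = A.tb (A.sharp x) x • x := by
  obtain ⟨ε, a, b, c, rfl⟩ := exists_eq_elt h2 hx
  have ha := A.O.dot_conj_mul_cyclic a b c
  have hb := A.O.dot_conj_mul_cyclic b c a
  have hγ := fun i => (A.γ i).ne_zero
  rw [sharp_sharp_elt h2, smul_smul, sharp_elt h2, tb_elt h2]
  congr 1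
  simp only [Matrix.cons_val_zero, Matrix.cons_val_one, Matrix.cons_val, map_sub, map_smul,
    LinearMap.sub_apply, LinearMap.smul_apply, smul_eq_mul, A.O.dot_self]
  rw [A.O.dot_comm _ a, A.O.dot_comm _ b, A.O.dot_comm _ c, ← hb, ← ha]
  field_simp [hγ]
  ring

variable (A)

/-- The cubic norm structure of a reduced Albert algebra. -/
def cubicNormStructure (h2 : (2 : F) ≠ 0) (h3 : (3 : F) ≠ 0) : CubicNormStructure F A.J where
  T := A.tbLin.domRestrict₁₂ A.J A.J
  X := LinearMap.mk₂ F (fun x y => ⟨A.cross x y, cross_mem_J h2 x.2 y.2⟩)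
    (fun x y z => Subtype.ext (LinearMap.map_add₂ (A.crossLin h2) _ _ _))
    (fun r x y => Subtype.ext (LinearMap.map_smul₂ (A.crossLin h2) _ _ _))
    (fun x y z => Subtype.ext (map_add (A.crossLin h2 x) _ _))
    (fun r x y => Subtype.ext (map_smul (A.crossLin h2 x) _ _))
  one := ⟨1, A.one_mem_J⟩
  two_ne := h2
  three_ne := h3
  T_comm x y := A.tb_comm x y
  X_comm x y := Subtype.ext (A.cross_comm x y)
  T_X x y z := tb_cross h2 x.1 y.1 z.1
  T_nondeg x h := Subtype.ext (eq_zero_of_tb_eq_zero h2 x.2 fun y hy => h ⟨y, hy⟩)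
  X_one x := Subtype.ext <| by
    change A.cross 1 x = A.tb 1 x • (1 : A.M) - x
    rw [one_cross h2, A.tb_comm, tb_one h2]
  T_one_one := (tb_one h2 1).trans (A.trace_one h2)
  adjoint x := Subtype.ext <| by
    change (3 : F) • A.cross (A.cross x x) (A.cross x x)
      = (4 * A.tb (A.cross x x) x) • (x : A.M)
    have h := sharp_sharp h2 x.2
    have h₁ : A.cross (A.cross x x) (A.cross x x) = (8 : F) • A.sharp (A.sharp x) := by
      rw [cross_self h2 (x : A.M), ← A.crossLin_apply h2]
      simp only [map_smul, LinearMap.smul_apply]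
      rw [A.crossLin_apply h2, cross_self h2]
      module
    have h₂ : A.tb (A.cross x x) x = 2 * A.tb (A.sharp x) x := by
      rw [cross_self h2, ← A.tbLin_apply, map_smul, LinearMap.smul_apply, A.tbLin_apply,
        smul_eq_mul]
    rw [h₁, h₂, smul_comm, h]
    module

variable {A} {h2 : (2 : F) ≠ 0} {h3 : (3 : F) ≠ 0}

lemma coe_cubicNormStructure_X (x y : A.J) :
    ((A.cubicNormStructure h2 h3).X x y : A.M) = A.cross x y := rfl

lemma cubicNormStructure_T (x y : A.J) : (A.cubicNormStructure h2 h3).T x y = A.tb x y := rfl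

lemma coe_cubicNormStructure_one : ((A.cubicNormStructure h2 h3).one : A.M) = 1 := rfl

lemma coe_cubicNormStructure_jmul (x y : A.J) :
    ((A.cubicNormStructure h2 h3).jmul x y : A.M) = A.jmul x y := by
  simp only [CubicNormStructure.jmul, Submodule.coe_smul, Submodule.coe_add, Submodule.coe_sub,
    coe_cubicNormStructure_X, cubicNormStructure_T, coe_cubicNormStructure_one, tb_one h2,
    cross_eq h2]
  match_scalars <;> (field_simp; try ring)

lemma cubicNormStructure_norm (x : A.J) : (A.cubicNormStructure h2 h3).norm x = A.norm x := by
  have h : A.norm x = (3 : F)⁻¹ * A.tb (A.sharp x) x := by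
    have h₁ : A.tb (A.sharp x) x = A.tb (A.jmul x x) x - A.trace x * A.tb x x
        + (2 : F)⁻¹ * (A.trace x ^ 2 - A.tb x x) * A.trace x := by
      rw [← A.tbLin_apply (A.sharp x)]
      simp only [sharp, map_add, map_sub, map_smul, LinearMap.add_apply, LinearMap.sub_apply,
        LinearMap.smul_apply, tbLin_apply, smul_eq_mul, A.tb_comm 1, tb_one h2]
    have h₂ : ∀ y z : A.M, A.trace (y - z) = A.trace y - A.trace z := fun y z => by
      rw [sub_eq_add_neg, ← neg_one_smul F z, trace_add, trace_smul]
      ring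
    rw [h₁, norm, trace_add, h₂, trace_smul, trace_smul, A.tb_comm (A.jmul x x)]
    rfl
  rw [h, CubicNormStructure.norm, CubicNormStructure.sharp, map_smul, LinearMap.smul_apply,
    cubicNormStructure_T, coe_cubicNormStructure_X, cross_self h2, ← A.tbLin_apply, map_smul,
    LinearMap.smul_apply, smul_smul, inv_mul_cancel₀ h2, one_smul, A.tbLin_apply]

end ReducedAlbert

namespace ReducedAlbert

variable {F : Type u} [Field F] {A : ReducedAlbert.{u, v} F}

lemma elt_mul_self_diag (h2 : (2 : F) ≠ 0) (ε : Fin 3 → F) (a b c : A.O.C) :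
    (A.jmul (A.elt ε a b c) (A.elt ε a b c)) 0 0 = (ε 0 ^ 2 + (A.γ 0 : F)⁻¹ * A.γ 2 * A.O.n b
        + (A.γ 1 : F)⁻¹ * A.γ 0 * A.O.n c) • (1 : A.O.C) ∧
    (A.jmul (A.elt ε a b c) (A.elt ε a b c)) 1 1 = (ε 1 ^ 2 + (A.γ 1 : F)⁻¹ * A.γ 0 * A.O.n c
        + (A.γ 2 : F)⁻¹ * A.γ 1 * A.O.n a) • (1 : A.O.C) ∧
    (A.jmul (A.elt ε a b c) (A.elt ε a b c)) 2 2 = (ε 2 ^ 2 + (A.γ 2 : F)⁻¹ * A.γ 1 * A.O.n a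
        + (A.γ 0 : F)⁻¹ * A.γ 2 * A.O.n b) • (1 : A.O.C) := by
  have e : ∀ x : A.M, A.jmul x x = x * x := fun x => by
    rw [jmul, ← two_smul F (x * x), inv_smul_smul₀ h2]
  rw [e]
  refine ⟨?_, ?_, ?_⟩ <;>
  · simp [elt, Matrix.mul_apply, Fin.sum_univ_three]
    simp only [mul_smul_comm, smul_mul_assoc, A.O.mul_conj_self, A.O.conj_mul_self]
    module

lemma eq_zero_of_smul_jmul_self (h2 : (2 : F) ≠ 0) (h3 : (3 : F) ≠ 0) (f : A.J →ₗ[F] F)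
    (hf : ∀ y : A.J, ∃ r s : F, f y • A.jmul y y = r • (y : A.M) + s • (1 : A.M)) : f = 0 := by
  let φ : (Fin 3 → F) → A.O.C → A.O.C → A.O.C → F := fun ε a b c => f ⟨_, elt_mem_J ε a b c⟩
  have φ_add : ∀ ε ε' a a' b b' c c',
      φ (ε + ε') (a + a') (b + b') (c + c') = φ ε a b c + φ ε' a' b' c' := by
    intro ε ε' a a' b b' c c'
    rw [← map_add]
    exact congrArg f (Subtype.ext (elt_add ε ε' a b c a' b' c').symm)
  have φ_smul : ∀ (r : F) ε, φ (r • ε) 0 0 0 = r * φ ε 0 0 0 := by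
    intro r ε
    rw [← smul_eq_mul, ← map_smul]
    refine congrArg f (Subtype.ext ?_)
    simpa using (smul_elt r ε (0 : A.O.C) 0 0).symm
  have one_inj : ∀ r s : F, r • (1 : A.O.C) = s • (1 : A.O.C) → r = s := fun r s h => by
    have := congrArg (fun z => A.O.dot z 1) h
    simpa [OctonionAlgebra.dot_one_one, h2] using this
  have key : ∀ ε a b c, ∃ r s : F,
      φ ε a b c * (ε 0 ^ 2 + (A.γ 0 : F)⁻¹ * A.γ 2 * A.O.n b + (A.γ 1 : F)⁻¹ * A.γ 0 * A.O.n c)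
        = r * ε 0 + s ∧
      φ ε a b c * (ε 1 ^ 2 + (A.γ 1 : F)⁻¹ * A.γ 0 * A.O.n c + (A.γ 2 : F)⁻¹ * A.γ 1 * A.O.n a)
        = r * ε 1 + s ∧
      φ ε a b c * (ε 2 ^ 2 + (A.γ 2 : F)⁻¹ * A.γ 1 * A.O.n a + (A.γ 0 : F)⁻¹ * A.γ 2 * A.O.n b)
        = r * ε 2 + s := by
    intro ε a b c
    obtain ⟨r, s, h⟩ := hf ⟨_, elt_mem_J ε a b c⟩
    obtain ⟨d₀, d₁, d₂⟩ := elt_mul_self_diag h2 ε a b c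
    have g := fun i => congrFun (congrFun h i) i
    simp only [Matrix.smul_apply, Matrix.add_apply, Matrix.one_apply_eq] at g
    refine ⟨r, s, one_inj _ _ ?_, one_inj _ _ ?_, one_inj _ _ ?_⟩
    · rw [mul_smul, ← d₀, add_smul, mul_smul]
      exact g 0
    · rw [mul_smul, ← d₁, add_smul, mul_smul]
      exact g 1
    · rw [mul_smul, ← d₂, add_smul, mul_smul]
      exact g 2
  have diag : ∀ ε : Fin 3 → F, ε 0 ≠ ε 1 → ε 1 ≠ ε 2 → ε 2 ≠ ε 0 → φ ε 0 0 0 = 0 := by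
    intro ε h₀ h₁ h₂
    obtain ⟨r, s, e₀, e₁, e₂⟩ := key ε 0 0 0
    simp only [map_zero, mul_zero, add_zero] at e₀ e₁ e₂
    have : φ ε 0 0 0 * ((ε 0 - ε 1) * (ε 1 - ε 2) * (ε 2 - ε 0)) = 0 := by
      linear_combination (ε 2 - ε 1) * e₀ + (ε 0 - ε 2) * e₁ + (ε 1 - ε 0) * e₂
    simpa [sub_eq_zero, h₀, h₁, h₂] using this
  have ne : (1 : F) ≠ -1 := fun h => h2 (by linear_combination h)
  have ne2 : (2 : F) ≠ -1 := fun h => h3 (by linear_combination h)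
  have φ_sub : ∀ ε ε' ε'' : Fin 3 → F, ∀ r : F, r ≠ 0 → φ ε 0 0 0 = 0 → φ ε' 0 0 0 = 0 →
      ε = ε' + r • ε'' → φ ε'' 0 0 0 = 0 := by
    rintro ε ε' ε'' r hr h h' rfl
    have := φ_add ε' (r • ε'') 0 0 0 0 0 0
    simp only [add_zero, h, h', φ_smul, zero_add, zero_eq_mul, hr, false_or] at this
    exact this
  have ne1 : (2 : F) ≠ 1 := fun h => one_ne_zero (α := F) (by linear_combination h)
  have z₀ : φ ![1, 0, 0] 0 0 0 = 0 :=
    φ_sub ![2, 1, -1] ![0, 1, -1] _ 2 h2 (diag _ ne1 ne ne2.symm)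
      (diag _ zero_ne_one ne (neg_ne_zero.mpr one_ne_zero)) (by ext i; fin_cases i <;> simp)
  have z₁ : φ ![0, 1, 0] 0 0 0 = 0 :=
    φ_sub ![1, 2, -1] ![1, 0, -1] _ 2 h2 (diag _ ne1.symm ne2 ne.symm)
      (diag _ one_ne_zero (neg_ne_zero.mpr one_ne_zero).symm ne.symm)
      (by ext i; fin_cases i <;> simp)
  have z₂ : φ ![0, 0, 1] 0 0 0 = 0 :=
    φ_sub ![1, -1, 2] ![1, -1, 0] _ 2 h2 (diag _ ne ne2.symm ne1)
      (diag _ ne (neg_ne_zero.mpr one_ne_zero) zero_ne_one) (by ext i; fin_cases i <;> simp)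
  have z : ∀ ε, φ ε 0 0 0 = 0 := fun ε => by
    have h : ε = ε 0 • ![1, 0, 0] + ε 1 • ![0, 1, 0] + ε 2 • ![0, 0, 1] := by
      ext i; fin_cases i <;> simp
    have h₁ := φ_add (ε 0 • ![1, 0, 0] + ε 1 • ![0, 1, 0]) (ε 2 • ![0, 0, 1]) 0 0 0 0 0 0
    have h₂ := φ_add (ε 0 • ![1, 0, 0]) (ε 1 • ![0, 1, 0]) 0 0 0 0 0 0
    simp only [add_zero, φ_smul, z₀, z₁, z₂, mul_zero, ← h] at h₁ h₂
    rw [h₁, h₂]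
  have φ_eq : ∀ ε a b c, φ ε a b c = φ 0 a 0 0 + φ 0 0 b 0 + φ 0 0 0 c := fun ε a b c => by
    have h₁ := φ_add ε 0 0 a 0 b 0 c
    have h₂ := φ_add 0 0 a 0 0 b 0 c
    have h₃ := φ_add 0 0 0 0 b 0 0 c
    simp only [add_zero, zero_add, z] at h₁ h₂ h₃
    rw [h₁, h₂, h₃, add_assoc]
  have za : ∀ a, φ 0 a 0 0 = 0 := fun a => by
    have h : ∀ ε, φ ε a 0 0 = φ 0 a 0 0 := fun ε => by
      simpa [z] using φ_add ε 0 0 a 0 0 0 0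
    obtain ⟨r, s, e₀, e₁, e₂⟩ := key ![0, 1, -1] a 0 0
    obtain ⟨r', s', f₀, f₁, f₂⟩ := key ![1, 1, -1] a 0 0
    simp [h] at e₀ e₁ e₂ f₀ f₁ f₂
    exact (mul_eq_zero.mp (by linear_combination 2 * f₀ - 2 * f₁ + e₁ + e₂ - 2 * e₀)).resolve_left h2
  have zb : ∀ b, φ 0 0 b 0 = 0 := fun b => by
    have h : ∀ ε, φ ε 0 b 0 = φ 0 0 b 0 := fun ε => by
      simpa [z] using φ_add ε 0 0 0 0 b 0 0
    obtain ⟨r, s, e₀, e₁, e₂⟩ := key ![1, 0, -1] 0 b 0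
    obtain ⟨r', s', f₀, f₁, f₂⟩ := key ![1, 1, -1] 0 b 0
    simp [h] at e₀ e₁ e₂ f₀ f₁ f₂
    exact (mul_eq_zero.mp (by linear_combination 2 * f₁ - 2 * f₀ + e₀ + e₂ - 2 * e₁)).resolve_left h2
  have zc : ∀ c, φ 0 0 0 c = 0 := fun c => by
    have h : ∀ ε, φ ε 0 0 c = φ 0 0 0 c := fun ε => by
      simpa [z] using φ_add ε 0 0 0 0 0 0 c
    obtain ⟨r, s, e₀, e₁, e₂⟩ := key ![1, -1, 0] 0 0 c
    obtain ⟨r', s', f₀, f₁, f₂⟩ := key ![1, -1, 1] 0 0 c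
    simp [h] at e₀ e₁ e₂ f₀ f₁ f₂
    exact (mul_eq_zero.mp (by linear_combination 2 * f₂ - 2 * f₀ + e₀ + e₁ - 2 * e₂)).resolve_left h2
  ext ⟨x, hx⟩
  obtain ⟨ε, a, b, c, rfl⟩ := exists_eq_elt h2 hx
  exact (φ_eq ε a b c).trans (by rw [za, zb, zc, add_zero, add_zero]; rfl)

instance : FiniteDimensional F A.O.C :=
  Module.finite_of_finrank_pos (by rw [A.O.finrank_eq]; norm_num)

instance : FiniteDimensional F A.J := inferInstance

variable (A) in
/-- The inclusion of the Brown algebra of `A` into its ambient space. -/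
def brownInclusion : (F × A.J × A.J × F) →ₗ[F] A.Bam :=
  LinearMap.id.prodMap (A.J.subtype.prodMap (A.J.subtype.prodMap LinearMap.id))

lemma brownInclusion_apply (x : F × A.J × A.J × F) :
    A.brownInclusion x = (x.1, (x.2.1 : A.M), (x.2.2.1 : A.M), x.2.2.2) := rfl

lemma brownInclusion_injective : Function.Injective A.brownInclusion := by
  rintro ⟨α, j, k, β⟩ ⟨α', j', k', β'⟩ h
  simpa [brownInclusion_apply] using h

lemma range_brownInclusion : LinearMap.range A.brownInclusion = A.Bsub := by
  ext ⟨α, j, k, β⟩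
  constructor
  · rintro ⟨x, hx⟩
    exact hx ▸ ⟨x.2.1.2, x.2.2.1.2⟩
  · rintro ⟨hj, hk⟩
    exact ⟨(α, ⟨j, hj⟩, ⟨k, hk⟩, β), rfl⟩

end ReducedAlbert

namespace ReducedAlbert

variable {F : Type u} [Field F] {A : ReducedAlbert.{u, v} F}

variable {h2 : (2 : F) ≠ 0} {h3 : (3 : F) ≠ 0}

lemma bform_brownInclusion (x y : F × A.J × A.J × F) :
    A.bform 1 (A.brownInclusion x) (A.brownInclusion y)
      = (A.cubicNormStructure h2 h3).brownForm x y := by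
  simp only [bform, bformS, bmul, binv, s0, brownInclusion_apply, CubicNormStructure.brownForm,
    cubicNormStructure_T, Prod.fst_sub, ← A.tbLin_apply, map_zero]
  ring

lemma tform_brownInclusion (x y w : F × A.J × A.J × F) :
    A.tform 1 (A.brownInclusion x) (A.brownInclusion y) (A.brownInclusion w)
      = A.brownInclusion ((A.cubicNormStructure h2 h3).brownTriple x y w) := by
  obtain ⟨α, j, k, β⟩ := x
  obtain ⟨α', j', k', β'⟩ := y
  obtain ⟨α'', j'', k'', β''⟩ := w
  have hT := fun x y => A.tb_comm x y
  have hX := fun x y => A.cross_comm x y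
  have hTX := fun x y z => tb_cross h2 (A := A) x y z
  simp only [← A.tbLin_apply, ← A.crossLin_apply h2] at hT hX hTX
  simp only [tform, tformS, brace, bformS, bmul, binv, s0, brownInclusion_apply,
    CubicNormStructure.brownTriple, CubicNormStructure.brownPairing,
    cubicNormStructure_T, Submodule.coe_add, Submodule.coe_sub,
    Submodule.coe_smul, Submodule.coe_neg, coe_cubicNormStructure_X]
  simp only [← A.tbLin_apply, ← A.crossLin_apply h2]
  generalize A.tbLin = T at *
  generalize A.crossLin h2 = X at *
  refine Prod.ext ?_ (Prod.ext ?_ (Prod.ext ?_ ?_)) <;>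
    simp only [Prod.fst_sub, Prod.snd_sub, Prod.fst_add, Prod.snd_add, Prod.smul_fst,
      Prod.smul_snd, map_zero, map_add, map_sub, map_smul, map_neg, LinearMap.add_apply,
      LinearMap.smul_apply, LinearMap.neg_apply,
      LinearMap.zero_apply, smul_eq_mul, smul_zero, one_smul, one_mul, mul_zero, add_zero, zero_add, mul_one, smul_neg, neg_smul, mul_neg, neg_mul]
  · have h₁ : T (X k' k'') k = T (X k k') k'' := by rw [hT, ← hTX]
    have h₂ : T (X k k'') k' = T (X k k') k'' := by rw [hTX, hX k'', ← hTX]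
    rw [hX k'' k', hX k'' k, h₁, h₂]
    ring
  · rw [hX k' k, hX k'' k, hX k'' k', hX j'' j, hX j'' j']
    module
  · rw [hX j' j, hX j'' j, hX j'' j', hX k'' k, hX k'' k', hT j k']
    module
  · have h₁ : T j'' (X j j') = T (X j j') j'' := hT _ _
    have h₂ : T j (X j' j'') = T (X j j') j'' := (hTX _ _ _).symm
    have h₃ : T j' (X j j'') = T (X j j') j'' := by rw [← hTX, hX]
    rw [hX j'' j, hX j'' j', h₁, h₂, h₃]
    ring

end ReducedAlbert

section Intertwining

variable {F M M' V V' : Type*} [Field F] [AddCommGroup M] [Module F M] [AddCommGroup M']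
  [Module F M'] [AddCommGroup V] [Module F V] [AddCommGroup V'] [Module F V']

lemma exists_linearEquiv_of_bijOn_range {p : V →ₗ[F] M} {q : V' →ₗ[F] M'}
    (hp : Function.Injective p) (hq : Function.Injective q) {f : M →ₗ[F] M'}
    (hf : Set.BijOn f (LinearMap.range p) (LinearMap.range q)) :
    ∃ e : V ≃ₗ[F] V', ∀ x, f (p x) = q (e x) := by
  obtain ⟨r, hr⟩ := q.exists_leftInverse_of_injective (LinearMap.ker_eq_bot.mpr hq)
  have hr' : ∀ x, r (q x) = x := LinearMap.congr_fun hr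
  have h : ∀ x, q (r (f (p x))) = f (p x) := fun x => by
    obtain ⟨y, hy⟩ := hf.mapsTo ⟨x, rfl⟩
    rw [← hy, hr']
  refine ⟨LinearEquiv.ofBijective (r ∘ₗ f ∘ₗ p) ⟨fun x y hxy => hp ?_, fun y => ?_⟩,
    fun x => (h x).symm⟩
  · exact hf.injOn ⟨x, rfl⟩ ⟨y, rfl⟩ (by rw [← h x, ← h y]; exact congrArg q hxy)
  · obtain ⟨_, ⟨x, rfl⟩, hx⟩ := hf.surjOn ⟨y, rfl⟩
    exact ⟨x, (congrArg r hx).trans (hr' y)⟩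

lemma exists_bijOn_range_of_linearEquiv {p : V →ₗ[F] M} {q : V' →ₗ[F] M'}
    (hp : Function.Injective p) (hq : Function.Injective q) (e : V ≃ₗ[F] V') :
    ∃ f : M →ₗ[F] M', Set.BijOn f (LinearMap.range p) (LinearMap.range q) ∧
      ∀ x, f (p x) = q (e x) := by
  obtain ⟨r, hr⟩ := p.exists_leftInverse_of_injective (LinearMap.ker_eq_bot.mpr hp)
  have hr' : ∀ x, r (p x) = x := LinearMap.congr_fun hr
  have h : ∀ x, (q ∘ₗ e.toLinearMap ∘ₗ r) (p x) = q (e x) := fun x => by simp [hr']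
  refine ⟨q ∘ₗ e.toLinearMap ∘ₗ r, ⟨?_, ?_, ?_⟩, h⟩
  · rintro _ ⟨x, rfl⟩
    exact ⟨e x, (h x).symm⟩
  · rintro _ ⟨x, rfl⟩ _ ⟨y, rfl⟩ hxy
    rw [h, h] at hxy
    rw [e.injective (hq hxy)]
  · rintro _ ⟨y, rfl⟩
    exact ⟨p (e.symm y), ⟨_, rfl⟩, by rw [h, e.apply_symm_apply]⟩

end Intertwining

namespace ReducedAlbert

variable {F : Type u} [Field F] (h2 : (2 : F) ≠ 0) (h3 : (3 : F) ≠ 0)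
  (A₁ A₂ : ReducedAlbert.{u, v} F)

lemma exists_similarity_iff :
    (∃ (lam : Fˣ) (f : A₁.Bam →ₗ[F] A₂.Bam),
      Set.BijOn f (A₁.Bsub : Set A₁.Bam) (A₂.Bsub : Set A₂.Bam) ∧
      (∀ x ∈ A₁.Bsub, ∀ y ∈ A₁.Bsub,
        A₂.bform 1 (f x) (f y) = (lam : F) * A₁.bform 1 x y) ∧
      (∀ x ∈ A₁.Bsub, ∀ y ∈ A₁.Bsub, ∀ z ∈ A₁.Bsub,
        A₂.tform 1 (f x) (f y) (f z) = (lam : F) • f (A₁.tform 1 x y z))) ↔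
    ∃ (c : F) (f : (F × A₁.J × A₁.J × F) ≃ₗ[F] (F × A₂.J × A₂.J × F)),
      c ≠ 0 ∧ CubicNormStructure.IsBrownSimilarity (A₁.cubicNormStructure h2 h3)
        (A₂.cubicNormStructure h2 h3) c f := by
  simp only [← range_brownInclusion]
  constructor
  · rintro ⟨c, f, hf, hb, ht⟩
    obtain ⟨e, he⟩ :=
      exists_linearEquiv_of_bijOn_range brownInclusion_injective brownInclusion_injective hf
    refine ⟨c, e, c.ne_zero, fun x y => ?_, fun x y z => A₂.brownInclusion_injective ?_⟩
    · rw [← bform_brownInclusion, ← bform_brownInclusion, ← he, ← he, hb _ ⟨x, rfl⟩ _ ⟨y, rfl⟩]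
    · rw [← tform_brownInclusion, ← he, ← he, ← he, ht _ ⟨x, rfl⟩ _ ⟨y, rfl⟩ _ ⟨z, rfl⟩,
        tform_brownInclusion (h2 := h2) (h3 := h3), he, map_smul]
  · rintro ⟨c, e, hc, he⟩
    obtain ⟨f, hf, hfe⟩ := exists_bijOn_range_of_linearEquiv (A₁.brownInclusion_injective)
      (A₂.brownInclusion_injective) e
    refine ⟨Units.mk0 c hc, f, hf, ?_, ?_⟩
    · rintro _ ⟨x, rfl⟩ _ ⟨y, rfl⟩
      rw [hfe, hfe, bform_brownInclusion (h2 := h2) (h3 := h3),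
        bform_brownInclusion (h2 := h2) (h3 := h3), he.form]
      rfl
    · rintro _ ⟨x, rfl⟩ _ ⟨y, rfl⟩ _ ⟨z, rfl⟩
      rw [hfe, hfe, hfe, tform_brownInclusion (h2 := h2) (h3 := h3),
        tform_brownInclusion (h2 := h2) (h3 := h3), he.triple, hfe, map_smul]
      rfl

lemma exists_isotopy_iff :
    (∃ u ∈ A₁.J, A₁.norm u ≠ 0 ∧
      ∃ g : A₁.M →ₗ[F] A₂.M,
        Set.BijOn g (A₁.J : Set A₁.M) (A₂.J : Set A₂.M) ∧
        ∀ x ∈ A₁.J, ∀ y ∈ A₁.J,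
          g (A₁.jmul (A₁.jmul x u) y + A₁.jmul (A₁.jmul y u) x - A₁.jmul (A₁.jmul x y) u)
            = A₂.jmul (g x) (g y)) ↔
    ∃ u, (A₁.cubicNormStructure h2 h3).norm u ≠ 0 ∧ ∃ g : A₁.J ≃ₗ[F] A₂.J, ∀ x y,
      g ((A₁.cubicNormStructure h2 h3).isoMul u x y)
        = (A₂.cubicNormStructure h2 h3).jmul (g x) (g y) := by
  have hmul : ∀ u x y : A₁.J, (((A₁.cubicNormStructure h2 h3).isoMul u x y : A₁.J) : A₁.M)
      = A₁.jmul (A₁.jmul x u) y + A₁.jmul (A₁.jmul y u) x - A₁.jmul (A₁.jmul x y) u := by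
    intro u x y
    simp only [← CubicNormStructure.jmul_isotope, Submodule.coe_sub, Submodule.coe_add,
      coe_cubicNormStructure_jmul]
  have inj : ∀ A : ReducedAlbert.{u, v} F, Function.Injective A.J.subtype := fun A =>
    A.J.injective_subtype
  constructor
  · rintro ⟨u, hu, hN, g, hg, hgm⟩
    obtain ⟨e, he⟩ := exists_linearEquiv_of_bijOn_range (inj A₁) (inj A₂) (f := g)
      (by simpa only [Submodule.range_subtype] using hg)
    refine ⟨⟨u, hu⟩, by rwa [cubicNormStructure_norm], e, fun x y => Subtype.ext ?_⟩
    refine (he _).symm.trans ?_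
    rw [Submodule.subtype_apply, hmul, hgm x x.2 y y.2, coe_cubicNormStructure_jmul]
    exact congrArg₂ _ (he x) (he y)
  · rintro ⟨u, hN, e, he⟩
    obtain ⟨g, hg, hge⟩ := exists_bijOn_range_of_linearEquiv (inj A₁) (inj A₂) e
    rw [Submodule.range_subtype, Submodule.range_subtype] at hg
    refine ⟨u, u.2, by rwa [cubicNormStructure_norm] at hN, g, hg, fun x hx y hy => ?_⟩
    have h₁ := hge ⟨x, hx⟩
    have h₂ := hge ⟨y, hy⟩
    have h₃ := hge ((A₁.cubicNormStructure h2 h3).isoMul u ⟨x, hx⟩ ⟨y, hy⟩)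
    rw [he] at h₃
    simp only [Submodule.subtype_apply, hmul, coe_cubicNormStructure_jmul] at h₁ h₂ h₃
    rw [h₃, h₁, h₂]

end ReducedAlbert

/-- `B(J₁,F×F)` and `B(J₂,F×F)` are similar (there is a similarity between
their associated triple systems) if and only if `J₁` and `J₂` are isotopic Jordan algebras. -/
theorem stmt5 {F : Type u} [Field F] (h2 : (2 : F) ≠ 0) (h3 : (3 : F) ≠ 0)
    (A₁ : ReducedAlbert.{u, v} F) (A₂ : ReducedAlbert.{u, v} F) :
    -- similarity between the associated triple systems
    (∃ (lam : Fˣ) (f : A₁.Bam →ₗ[F] A₂.Bam),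
      Set.BijOn f (A₁.Bsub : Set A₁.Bam) (A₂.Bsub : Set A₂.Bam) ∧
      (∀ x ∈ A₁.Bsub, ∀ y ∈ A₁.Bsub,
        A₂.bform 1 (f x) (f y) = (lam : F) * A₁.bform 1 x y) ∧
      (∀ x ∈ A₁.Bsub, ∀ y ∈ A₁.Bsub, ∀ z ∈ A₁.Bsub,
        A₂.tform 1 (f x) (f y) (f z) = (lam : F) • f (A₁.tform 1 x y z))) ↔
    -- J₁ and J₂ are isotopic: J₂ ≅ J₁^⟨u⟩ for some u ∈ J₁ with N(u) ≠ 0, where the isotope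
    -- J₁^⟨u⟩ has product x∘y = (x·u)·y + (y·u)·x − (x·y)·u
    (∃ u ∈ A₁.J, A₁.norm u ≠ 0 ∧
      ∃ g : A₁.M →ₗ[F] A₂.M,
        Set.BijOn g (A₁.J : Set A₁.M) (A₂.J : Set A₂.M) ∧
        ∀ x ∈ A₁.J, ∀ y ∈ A₁.J,
          g (A₁.jmul (A₁.jmul x u) y + A₁.jmul (A₁.jmul y u) x - A₁.jmul (A₁.jmul x y) u)
            = A₂.jmul (g x) (g y)) := by
  rw [ReducedAlbert.exists_similarity_iff h2 h3, ReducedAlbert.exists_isotopy_iff h2 h3]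
  refine CubicNormStructure.exists_isBrownSimilarity_iff_isotopic fun f hf =>
    ReducedAlbert.eq_zero_of_smul_jmul_self h2 h3 f fun y => ?_
  obtain ⟨r, s, h⟩ := hf y
  refine ⟨r, s, ?_⟩
  rw [← ReducedAlbert.coe_cubicNormStructure_jmul (h2 := h2) (h3 := h3)]
  exact congrArg Subtype.val h
end
end

section
/- Two Brown algebras over a field F of characteristic not 2 or 3 are similar (i.e., for some — equivalently, any — choices of spanning skew-symmetric elements, there is a similarity between their associated triple systems) if and only if they are isotopic as structurable algebras. -/
set_option synthInstance.maxHeartbeats 1000000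
set_option maxHeartbeats 1000000

noncomputable section

open scoped TensorProduct

universe u v

/-- The separable closure of `F` (inside an algebraic closure). -/
abbrev Fsep (F : Type u) [Field F] : Type u :=
  ↥(separableClosure F (AlgebraicClosure F))

/-- A Brown algebra over `F`: a 56-dimensional `F`-algebra with `F`-linear involution which
becomes isomorphic to the split Brown algebra `B(Jᵈ, K×K)` after base change to the separable
closure `K` of `F`. -/
structure BrownAlgebra (F : Type u) [Field F] : Type (u + 1) where
  B : Type u
  [ringB : NonAssocRing B]
  [modB : Module F B]
  [sccB : SMulCommClass F B B]
  [istB : IsScalarTower F B B]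
  ι : B →ₗ[F] B
  ι_invol : ∀ x, ι (ι x) = x
  ι_antimul : ∀ x y : B, ι (x * y) = ι y * ι x
  finrank56 : Module.finrank F B = 56
  /-- After base change to the separable closure `K = Fsep F`, the algebra with involution is
  isomorphic to the split Brown algebra `B(Jᵈ, K×K)` (for `Jᵈ` the split Albert algebra over
  `K`), via a `K`-linear bijection onto the 56-dimensional subspace `Bsub` of the ambient model
  which intertwines the multiplications and involutions. -/
  split : ∃ A : ReducedAlbert.{u, u} (Fsep F), A.IsSplitAlbert ∧
    ∃ f : (Fsep F) ⊗[F] B →ₗ[Fsep F] A.Bam,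
      Function.Injective f ∧ LinearMap.range f = A.Bsub ∧
      (∀ x y : B, f ((1 : Fsep F) ⊗ₜ[F] (x * y))
          = A.bmul 1 (f ((1 : Fsep F) ⊗ₜ[F] x)) (f ((1 : Fsep F) ⊗ₜ[F] y))) ∧
      (∀ x : B, f ((1 : Fsep F) ⊗ₜ[F] (ι x)) = A.binv (f ((1 : Fsep F) ⊗ₜ[F] x)))

attribute [instance] BrownAlgebra.ringB BrownAlgebra.modB BrownAlgebra.sccB BrownAlgebra.istB

namespace BrownAlgebra

variable {F : Type u} [Field F] (Br : BrownAlgebra F)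

/-- The triple product `{x,y,z} := (x·ȳ)·z + (z·ȳ)·x − (z·x̄)·y`. -/
def braceA (x y z : Br.B) : Br.B :=
  (x * Br.ι y) * z + (z * Br.ι y) * x - (z * Br.ι x) * y

/-- `s₀` spans the (1-dimensional) space of skew-symmetric elements. -/
def IsSkewGen (s0 : Br.B) : Prop := s0 ≠ 0 ∧ Br.ι s0 = -s0

/-- `bB` is the skew-symmetric bilinear form of the triple system associated to `Br` and the
skew element `s₀`: `b(x,y)` is the unique scalar with `b(x,y)•1 = (x·ȳ − y·x̄)·s₀`. -/
def IsBForm (s0 : Br.B) (bB : Br.B → Br.B → F) : Prop :=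
  ∀ x y : Br.B, bB x y • (1 : Br.B) = (x * Br.ι y - y * Br.ι x) * s0

/-- The trilinear product of the triple system associated to `Br`, `s₀` and `bB`:
`t(y,z,w) := 2{y, s₀·z, w} − b(z,w)·y − b(z,y)·w − b(y,w)·z`. -/
def tripleT (s0 : Br.B) (bB : Br.B → Br.B → F) (y z w : Br.B) : Br.B :=
  (2 : F) • Br.braceA y (s0 * z) w - bB z w • y - bB z y • w - bB y w • z

/-- An element `e` is singular: `e ≠ 0` and `U_e(B) ⊆ F·e` where `U_e x := {e,x,e}`. -/
def IsSingularA (e : Br.B) : Prop :=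
  e ≠ 0 ∧ ∀ x : Br.B, ∃ c : F, Br.braceA e x e = c • e

/-- `I` is an inner ideal: `U_e(B) ⊆ I` for all `e ∈ I`. -/
def IsInnerIdealA (I : Submodule F Br.B) : Prop :=
  ∀ e ∈ I, ∀ x : Br.B, Br.braceA e x e ∈ I

end BrownAlgebra

/-- If `1 ⊗ x = k ⊗ y` over a field extension, with `y ≠ 0`, then `k` is defined over the base
field and `x` is the corresponding multiple of `y`. -/
lemma exists_eq_smul_of_one_tmul_eq {F K V : Type*} [Field F] [Field K] [Algebra F K]
    [AddCommGroup V] [Module F V] {x y : V} {k : K} (hy : y ≠ 0)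
    (h : (1 : K) ⊗ₜ[F] x = k ⊗ₜ[F] y) : ∃ a : F, k = algebraMap F K a ∧ x = a • y := by
  obtain ⟨φ, hφ⟩ := Module.Projective.exists_dual_ne_zero F hy
  have hk : algebraMap F K (φ x) = k * algebraMap F K (φ y) := by
    have := congrArg (TensorProduct.rid F K ∘ LinearMap.lTensor K φ) h
    simpa [Algebra.smul_def, mul_comm] using this
  have hk' : k = algebraMap F K (φ x / φ y) := by
    have : algebraMap F K (φ y) ≠ 0 := by simpa using hφ
    rw [map_div₀, hk, mul_div_cancel_right₀ _ this]
  refine ⟨φ x / φ y, hk', ?_⟩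
  apply Module.FaithfullyFlat.tensorProduct_mk_injective (A := F) (B := K) V
  simp only [TensorProduct.mk_apply]
  rw [h, hk', Algebra.algebraMap_eq_smul_one, TensorProduct.smul_tmul]

namespace ReducedAlbert

variable {F : Type u} [Field F] (A : ReducedAlbert.{u, v} F)

lemma jmul_zero_left (y : A.M) : A.jmul 0 y = 0 := by simp [jmul]

lemma jmul_zero_right (y : A.M) : A.jmul y 0 = 0 := by simp [jmul]

lemma trace_zero : A.trace 0 = 0 := by simp [trace, QuadraticMap.polar]

lemma tb_zero_left (y : A.M) : A.tb 0 y = 0 := by simp [tb, jmul_zero_left, trace_zero]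

lemma tb_zero_right (y : A.M) : A.tb y 0 = 0 := by simp [tb, jmul_zero_right, trace_zero]

lemma cross_zero_left (y : A.M) : A.cross 0 y = 0 := by
  simp [cross, sharp, jmul_zero_left, tb_zero_left, trace_zero]

lemma bmul_smul_s0 (ζ c : F) (y : A.Bam) :
    A.bmul ζ (c • A.s0) y = (c * y.1, c • y.2.1, -c • y.2.2.1, -c * y.2.2.2) := by
  simp [bmul, s0, tb_zero_left, tb_zero_right, cross_zero_left]

lemma bmul_smul_s0_bmul_smul_s0 (ζ c : F) (y : A.Bam) :
    A.bmul ζ (c • A.s0) (A.bmul ζ (c • A.s0) y) = (c * c) • y := by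
  rw [bmul_smul_s0, bmul_smul_s0]
  ext1 <;> [skip; ext1] <;> [skip; skip; ext1] <;> simp [mul_smul]

lemma eq_smul_s0_of_binv_eq_neg (h2 : (2 : F) ≠ 0) {y : A.Bam} (hy : A.binv y = -y) :
    y = y.1 • A.s0 := by
  obtain ⟨α, j, j', β⟩ := y
  have aux : ∀ m : A.M, m = -m → m = 0 := fun m hm ↦ by
    have : (2 : F) • m = 0 := by rw [two_smul]; nth_rewrite 1 [hm]; simp
    exact (smul_eq_zero.mp this).resolve_left h2
  simp only [binv, Prod.neg_mk, Prod.mk.injEq] at hy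
  obtain ⟨h1, hj, hj', -⟩ := hy
  simp [s0, aux _ hj, aux _ hj', h1]

lemma binv_s0 : A.binv A.s0 = -A.s0 := by simp [binv, s0]

lemma s0_mem_Bsub : A.s0 ∈ A.Bsub := ⟨A.J.zero_mem, A.J.zero_mem⟩

/-- The involution of `B(J, F×F, ζ)` as a linear map. -/
def binvₗ : A.Bam →ₗ[F] A.Bam where
  toFun := A.binv
  map_add' _ _ := rfl
  map_smul' _ _ := rfl

end ReducedAlbert

lemma Fsep.two_ne_zero {F : Type u} [Field F] (h2 : (2 : F) ≠ 0) : (2 : Fsep F) ≠ 0 := by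
  rw [← map_ofNat (algebraMap F (Fsep F)) 2]
  exact (map_ne_zero _).mpr h2

namespace BrownAlgebra

variable {F : Type u} [Field F] {Br : BrownAlgebra F}

lemma one_ne_zero (Br : BrownAlgebra F) : (1 : Br.B) ≠ 0 := by
  intro h
  have : Subsingleton Br.B := ⟨fun a b ↦ by rw [← mul_one a, ← mul_one b, h, mul_zero, mul_zero]⟩
  have := Br.finrank56
  rw [Module.finrank_zero_of_subsingleton] at this
  omega

lemma exists_isSkewGen (h2 : (2 : F) ≠ 0) (Br : BrownAlgebra F) : ∃ s : Br.B, Br.IsSkewGen s := by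
  obtain ⟨A, -, f, -, hrange, -, hinv⟩ := Br.split
  by_contra! hns
  have hfix : ∀ x, Br.ι x = x := fun x ↦ by
    by_contra hx
    refine hns (x - Br.ι x) ⟨sub_ne_zero.mpr (Ne.symm hx), ?_⟩
    rw [map_sub, Br.ι_invol, neg_sub]
  have hbinv : ∀ t, A.binvₗ (f t) = f t := fun t ↦ by
    induction t with
    | zero => simp
    | add a b ha hb => simp [ha, hb]
    | tmul k x =>
      have hk : k ⊗ₜ[F] x = k • ((1 : Fsep F) ⊗ₜ[F] x) := by simp [TensorProduct.smul_tmul']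
      rw [hk, map_smul, map_smul]
      congr 1
      exact (hinv x).symm.trans (by rw [hfix])
  obtain ⟨t, ht⟩ : A.s0 ∈ LinearMap.range f := hrange ▸ A.s0_mem_Bsub
  have h := hbinv t
  rw [ht] at h
  have h1 : (-1 : Fsep F) = 1 := congrArg Prod.fst (A.binv_s0.symm.trans h)
  apply Fsep.two_ne_zero h2
  rw [← one_add_one_eq_two]
  nth_rewrite 1 [← h1]
  simp

lemma IsSkewGen.exists_smul_of_skew (h2 : (2 : F) ≠ 0) {s t : Br.B} (hs : Br.IsSkewGen s)
    (ht : Br.ι t = -t) : ∃ a : F, t = a • s := by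
  obtain ⟨A, -, f, hinj, -, -, hinv⟩ := Br.split
  have key : ∀ r : Br.B, Br.ι r = -r →
      f ((1 : Fsep F) ⊗ₜ[F] r) = (f ((1 : Fsep F) ⊗ₜ[F] r)).1 • A.s0 := fun r hr ↦
    A.eq_smul_s0_of_binv_eq_neg (Fsep.two_ne_zero h2)
      (by rw [← hinv, hr, TensorProduct.tmul_neg, map_neg])
  have h1 := key s hs.2
  have h3 := key t ht
  set c := (f ((1 : Fsep F) ⊗ₜ[F] s)).1
  set d := (f ((1 : Fsep F) ⊗ₜ[F] t)).1
  have hc : c ≠ 0 := fun hc ↦ by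
    rw [hc, zero_smul, ← map_zero f] at h1
    exact hs.1 (Module.FaithfullyFlat.tensorProduct_mk_injective (A := F) (B := Fsep F) Br.B
      ((hinj h1).trans (TensorProduct.tmul_zero _ _).symm))
  obtain ⟨a, -, ha⟩ := exists_eq_smul_of_one_tmul_eq (K := Fsep F) (k := d / c) (x := t) hs.1 (by
    apply hinj
    have hk : (d / c) ⊗ₜ[F] s = (d / c) • ((1 : Fsep F) ⊗ₜ[F] s) := by
      simp [TensorProduct.smul_tmul']
    rw [hk, map_smul, h1, h3, smul_smul, div_mul_cancel₀ _ hc])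
  exact ⟨a, ha⟩

lemma IsSkewGen.exists_mul_mul_eq_smul (h2 : (2 : F) ≠ 0) {s : Br.B} (hs : Br.IsSkewGen s) :
    ∃ μ : F, μ ≠ 0 ∧ ∀ z, s * (s * z) = μ • z := by
  obtain ⟨A, -, f, hinj, -, hmul, hinv⟩ := Br.split
  have h1 := A.eq_smul_s0_of_binv_eq_neg (y := f ((1 : Fsep F) ⊗ₜ[F] s)) (Fsep.two_ne_zero h2)
    (by rw [← hinv, hs.2, TensorProduct.tmul_neg, map_neg])
  set c := (f ((1 : Fsep F) ⊗ₜ[F] s)).1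
  have hc : c ≠ 0 := fun hc ↦ by
    rw [hc, zero_smul, ← map_zero f] at h1
    exact hs.1 (Module.FaithfullyFlat.tensorProduct_mk_injective (A := F) (B := Fsep F) Br.B
      ((hinj h1).trans (TensorProduct.tmul_zero _ _).symm))
  have key : ∀ z, (1 : Fsep F) ⊗ₜ[F] (s * (s * z)) = (c * c) ⊗ₜ[F] z := fun z ↦ by
    apply hinj
    have hk : (c * c) ⊗ₜ[F] z = (c * c) • ((1 : Fsep F) ⊗ₜ[F] z) := by
      simp [TensorProduct.smul_tmul']
    rw [hmul, hmul, h1, A.bmul_smul_s0_bmul_smul_s0, hk, map_smul]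
  obtain ⟨μ, hμ, -⟩ := exists_eq_smul_of_one_tmul_eq Br.one_ne_zero (key 1)
  refine ⟨μ, ?_, fun z ↦ ?_⟩
  · rintro rfl
    rw [map_zero] at hμ
    exact mul_ne_zero hc hc hμ
  · apply Module.FaithfullyFlat.tensorProduct_mk_injective (A := F) (B := Fsep F) Br.B
    simp only [TensorProduct.mk_apply]
    rw [key, hμ, Algebra.algebraMap_eq_smul_one, TensorProduct.smul_tmul]

lemma ι_mul_sub_mul (x y : Br.B) :
    Br.ι (x * Br.ι y - y * Br.ι x) = -(x * Br.ι y - y * Br.ι x) := by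
  simp [Br.ι_antimul, Br.ι_invol]

lemma IsSkewGen.mul_sub_mul_eq_smul (h2 : (2 : F) ≠ 0) {s : Br.B} (hs : Br.IsSkewGen s)
    {μ : F} (hμ : ∀ z, s * (s * z) = μ • z) {b : Br.B → Br.B → F} (hb : Br.IsBForm s b)
    (x y : Br.B) : μ • (x * Br.ι y - y * Br.ι x) = b x y • s := by
  obtain ⟨a, ha⟩ := hs.exists_smul_of_skew h2 (ι_mul_sub_mul x y)
  have hss : s * s = μ • (1 : Br.B) := by simpa using hμ 1
  have h := hb x y
  rw [ha, smul_mul_assoc, hss, smul_smul] at h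
  rw [smul_left_injective F Br.one_ne_zero h, ha, smul_smul, mul_comm]

lemma IsSkewGen.exists_isBForm (h2 : (2 : F) ≠ 0) {s : Br.B} (hs : Br.IsSkewGen s) :
    ∃ b : Br.B → Br.B → F, Br.IsBForm s b := by
  obtain ⟨μ, -, hμ⟩ := hs.exists_mul_mul_eq_smul h2
  have hss : s * s = μ • (1 : Br.B) := by simpa using hμ 1
  choose a ha using fun x y : Br.B ↦ hs.exists_smul_of_skew h2 (ι_mul_sub_mul x y)
  exact ⟨fun x y ↦ a x y * μ, fun x y ↦ by rw [ha, smul_mul_assoc, hss, smul_smul]⟩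

lemma IsSkewGen.bForm_self_one {s : Br.B} (hs : Br.IsSkewGen s)
    {μ : F} (hμ : ∀ z, s * (s * z) = μ • z) {b : Br.B → Br.B → F} (hb : Br.IsBForm s b) :
    b s 1 = 2 * μ := by
  have hss : s * s = μ • (1 : Br.B) := by simpa using hμ 1
  have hι : Br.ι 1 = 1 := by
    have := Br.ι_antimul (Br.ι 1) 1
    rw [mul_one, Br.ι_invol, mul_one] at this
    exact this.symm
  apply smul_left_injective F Br.one_ne_zero
  simp only
  rw [hb, hι, hs.2, mul_one, one_mul, sub_neg_eq_add, add_mul, hss, ← two_smul F, smul_smul]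

lemma braceA_smul_middle (c : F) (x y z : Br.B) :
    Br.braceA x (c • y) z = c • Br.braceA x y z := by
  simp only [braceA, map_smul, mul_smul_comm, smul_mul_assoc, smul_add, smul_sub]

lemma IsSkewGen.braceA_sub_braceA (h2 : (2 : F) ≠ 0) {s : Br.B} (hs : Br.IsSkewGen s)
    {μ : F} (hμ : ∀ z, s * (s * z) = μ • z) {b : Br.B → Br.B → F} (hb : Br.IsBForm s b)
    (x y z : Br.B) : μ • (Br.braceA z y x - Br.braceA x y z) = b z x • (s * y) := by
  rw [← smul_mul_assoc, ← hs.mul_sub_mul_eq_smul h2 hμ hb, smul_mul_assoc]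
  congr 1
  simp only [braceA, sub_mul]
  abel

lemma two_smul_braceA (s : Br.B) (b : Br.B → Br.B → F) (y z w : Br.B) :
    (2 : F) • Br.braceA y (s * z) w
      = Br.tripleT s b y z w + b z w • y + b z y • w + b y w • z := by
  simp only [tripleT]
  abel

lemma mul_left_bijective {s : Br.B} {μ : F} (hμ0 : μ ≠ 0)
    (hμ : ∀ z, s * (s * z) = μ • z) : Function.Bijective (fun z : Br.B ↦ s * z) := by
  constructor
  · intro x y hxy
    have h := congrArg (s * ·) hxy
    simp only [hμ] at h
    exact smul_right_injective _ hμ0 h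
  · intro y
    exact ⟨μ⁻¹ • (s * y), by simp only [mul_smul_comm, hμ, inv_smul_smul₀ hμ0]⟩

end BrownAlgebra

/-- Two Brown algebras over `F` are similar (for any choices of spanning
skew-symmetric elements there is a similarity between the associated triple systems) if and
only if they are isotopic as structurable algebras. -/
theorem stmt6 {F : Type u} [Field F] (h2 : (2 : F) ≠ 0) (h3 : (3 : F) ≠ 0)
    (Br₁ Br₂ : BrownAlgebra F) :
    -- similar
    (∀ s₁ : Br₁.B, Br₁.IsSkewGen s₁ → ∀ s₂ : Br₂.B, Br₂.IsSkewGen s₂ →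
      ∀ b₁ : Br₁.B → Br₁.B → F, Br₁.IsBForm s₁ b₁ →
      ∀ b₂ : Br₂.B → Br₂.B → F, Br₂.IsBForm s₂ b₂ →
      ∃ (lam : Fˣ) (f : Br₁.B →ₗ[F] Br₂.B),
        Function.Bijective f ∧
        (∀ x y : Br₁.B, b₂ (f x) (f y) = (lam : F) * b₁ x y) ∧
        (∀ x y z : Br₁.B,
          Br₂.tripleT s₂ b₂ (f x) (f y) (f z) = (lam : F) • f (Br₁.tripleT s₁ b₁ x y z))) ↔
    -- isotopic as structurable algebras
    (∃ (α β : Br₁.B →ₗ[F] Br₂.B),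
      Function.Bijective α ∧ Function.Bijective β ∧
      ∀ x y z : Br₁.B, α (Br₁.braceA x y z) = Br₂.braceA (α x) (β y) (α z)) := by
  constructor
  · intro h
    obtain ⟨s₁, hs₁⟩ := Br₁.exists_isSkewGen h2
    obtain ⟨s₂, hs₂⟩ := Br₂.exists_isSkewGen h2
    obtain ⟨b₁, hb₁⟩ := hs₁.exists_isBForm h2
    obtain ⟨b₂, hb₂⟩ := hs₂.exists_isBForm h2
    obtain ⟨μ₁, hμ₁0, hμ₁⟩ := hs₁.exists_mul_mul_eq_smul h2
    obtain ⟨μ₂, hμ₂0, hμ₂⟩ := hs₂.exists_mul_mul_eq_smul h2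
    obtain ⟨lam, f, hf, hfb, hft⟩ := h s₁ hs₁ s₂ hs₂ b₁ hb₁ b₂ hb₂
    have hbrace : ∀ y z w, Br₂.braceA (f y) (s₂ * f z) (f w)
        = (lam : F) • f (Br₁.braceA y (s₁ * z) w) := fun y z w ↦ by
      apply smul_right_injective _ h2
      simp only
      rw [BrownAlgebra.two_smul_braceA s₂ b₂, smul_comm, ← map_smul f (2 : F),
        BrownAlgebra.two_smul_braceA s₁ b₁, hft]
      simp only [hfb, map_add, map_smul, smul_add, mul_smul]
    have hc : ((lam : F)⁻¹ * μ₁⁻¹) ≠ 0 := mul_ne_zero (inv_ne_zero lam.ne_zero) (inv_ne_zero hμ₁0)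
    refine ⟨f, ((lam : F)⁻¹ * μ₁⁻¹) •
      (LinearMap.mulLeft F s₂ ∘ₗ f ∘ₗ LinearMap.mulLeft F s₁), hf, ?_, fun x y z ↦ ?_⟩
    · have hbij := (BrownAlgebra.mul_left_bijective hμ₂0 hμ₂).comp
        (hf.comp (BrownAlgebra.mul_left_bijective hμ₁0 hμ₁))
      exact (LinearEquiv.smulOfNeZero F Br₂.B _ hc).bijective.comp hbij
    · simp only [LinearMap.smul_apply, LinearMap.comp_apply, LinearMap.mulLeft_apply]
      rw [BrownAlgebra.braceA_smul_middle, hbrace, hμ₁, BrownAlgebra.braceA_smul_middle, map_smul,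
        smul_smul, smul_smul]
      have : (lam : F)⁻¹ * μ₁⁻¹ * lam * μ₁ = 1 := by
        field_simp [lam.ne_zero]
      rw [this, one_smul]
  · rintro ⟨α, β, hα, hβ, hαβ⟩ s₁ hs₁ s₂ hs₂ b₁ hb₁ b₂ hb₂
    obtain ⟨μ₁, hμ₁0, hμ₁⟩ := hs₁.exists_mul_mul_eq_smul h2
    obtain ⟨μ₂, hμ₂0, hμ₂⟩ := hs₂.exists_mul_mul_eq_smul h2
    have key : ∀ x y z, (μ₂ * b₁ z x) • α (s₁ * y) = (μ₁ * b₂ (α z) (α x)) • (s₂ * β y) :=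
      fun x y z ↦ by
        rw [mul_smul, mul_smul, ← map_smul, ← hs₁.braceA_sub_braceA h2 hμ₁ hb₁,
          ← hs₂.braceA_sub_braceA h2 hμ₂ hb₂, map_smul, map_sub, hαβ, hαβ, smul_comm]
    have hb1 : b₁ s₁ 1 ≠ 0 := by
      rw [hs₁.bForm_self_one hμ₁ hb₁]
      exact mul_ne_zero h2 hμ₁0
    set c := μ₁ * b₂ (α s₁) (α 1) / (μ₂ * b₁ s₁ 1) with hc
    have hαs : ∀ y, α (s₁ * y) = c • (s₂ * β y) := fun y ↦ by
      rw [hc, div_eq_inv_mul, mul_smul, ← key, inv_smul_smul₀ (mul_ne_zero hμ₂0 hb1)]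
    have hs₁s : α (s₁ * 1) ≠ 0 := by
      rw [mul_one]
      exact (map_ne_zero_iff α hα.1).mpr hs₁.1
    have hc0 : c ≠ 0 := fun h ↦ hs₁s (by rw [hαs, h, zero_smul])
    have hsβ : s₂ * β 1 ≠ 0 := fun h ↦ hs₁s (by rw [hαs, h, smul_zero])
    set l := μ₂ * μ₁⁻¹ * c with hl
    have hl0 : l ≠ 0 := mul_ne_zero (mul_ne_zero hμ₂0 (inv_ne_zero hμ₁0)) hc0
    have hb : ∀ x y, b₂ (α x) (α y) = l * b₁ x y := fun x y ↦ by
      have h := key y 1 x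
      rw [hαs, smul_smul] at h
      have h' := smul_left_injective F hsβ h
      rw [hl]
      field_simp
      linear_combination -h'
    have hβs : ∀ z, s₂ * α z = l • β (s₁ * z) := fun z ↦ by
      have h := congrArg (s₂ * ·) (hαs (s₁ * z))
      rw [hμ₁, map_smul, mul_smul_comm, mul_smul_comm, hμ₂] at h
      apply smul_right_injective _ hμ₁0
      simp only
      rw [h, smul_smul, smul_smul, hl]
      congr 1
      field_simp
    refine ⟨Units.mk0 l hl0, α, hα, hb, fun x y z ↦ ?_⟩
    simp only [Units.val_mk0, BrownAlgebra.tripleT, map_sub, map_smul, smul_sub, hb, hαβ, hβs,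
      BrownAlgebra.braceA_smul_middle, mul_smul]
    rw [smul_comm (2 : F) l]
end
end
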